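/- Let p ∈ [1, ∞), μ ∈ P(X), ν ∈ P(Y), let c : X × Y → ℝ be continuous with growth of order at most p, and assume there exist finitely supported measures μ^n ∈ P(X), ν^n ∈ P(Y) with W_{p,bc}(μ^n, μ) → 0 and W_{p,bc}(ν^n, ν) → 0. Then lim_{ε → 0} E_•^ε(μ, ν, c) = V_•(μ, ν, c), and every weak accumulation point of the optimizers of E_•^ε(μ, ν, c) as ε ↘ 0 is an optimizer of V_•(μ, ν, c); here • stands for any of: no constraint, causal, anticausal, or bicausal. -/

import Mathlib

open MeasureTheory ProbabilityTheory Filter Set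
open scoped ENNReal NNReal Topology ProbabilityTheory

noncomputable section

namespace AOT

variable {N : ℕ}

/-- The σ-algebra on a path space generated by the `t`-th coordinate. -/
def coordσ (X : Fin N → Type*) [∀ t, MeasurableSpace (X t)] (t : Fin N) :
    MeasurableSpace (∀ s, X s) :=
  MeasurableSpace.comap (fun x => x t) inferInstance

/-- The σ-algebra generated by the coordinates (strictly) before time `t`, from a family
of coordinate σ-algebras. -/
def pastσOf {A : Type*} (m : Fin N → MeasurableSpace A) (t : ℕ) : MeasurableSpace A :=
  ⨆ s : Fin N, ⨆ _ : (s : ℕ) < t, m s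

/-- The σ-algebra on a path space generated by the coordinates before time `t`. -/
def pastσ (X : Fin N → Type*) [∀ t, MeasurableSpace (X t)] (t : ℕ) :
    MeasurableSpace (∀ s, X s) :=
  pastσOf (coordσ X) t

/-- Conditional independence of the sub-σ-algebras `m₁` and `m₂` given `m₃`, under the
measure `π`: for all sets `A ∈ m₁`, `B ∈ m₂`, the conditional expectation (given `m₃`)
of the indicator of `A ∩ B` is a.s. the product of those of `A` and of `B`. -/
def CondIndepσ {Ω : Type*} {mΩ : MeasurableSpace Ω} (m₁ m₂ m₃ : MeasurableSpace Ω)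
    (π : @Measure Ω mΩ) : Prop :=
  ∀ A B : Set Ω, MeasurableSet[m₁] A → MeasurableSet[m₂] B →
    (π[(A ∩ B).indicator (fun _ => (1 : ℝ)) | m₃]) =ᵐ[π]
      (π[A.indicator (fun _ => (1 : ℝ)) | m₃]) * (π[B.indicator (fun _ => (1 : ℝ)) | m₃])

/-- Causality of a measure on `A × B` relative to families of coordinate σ-algebras
`mA` on `A` and `mB` on `B`: for every time `t`, the `t`-th coordinate of the first
component is conditionally independent of the (strict) past of the second component,
given the (strict) past of the first component. -/
def IsCausalFor {A B : Type*} [MeasurableSpace A] [MeasurableSpace B]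
    (mA : Fin N → MeasurableSpace A) (mB : Fin N → MeasurableSpace B)
    (π : Measure (A × B)) : Prop :=
  ∀ t : Fin N,
    CondIndepσ ((mA t).comap Prod.fst)
      ((pastσOf mB (t : ℕ)).comap Prod.snd)
      ((pastσOf mA (t : ℕ)).comap Prod.fst) π

/-- Anticausality: causality with the roles of the two components exchanged. -/
def IsAnticausalFor {A B : Type*} [MeasurableSpace A] [MeasurableSpace B]
    (mA : Fin N → MeasurableSpace A) (mB : Fin N → MeasurableSpace B)
    (π : Measure (A × B)) : Prop :=
  IsCausalFor mB mA (π.map Prod.swap)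

/-- A coupling of a measure on `X₁ × ⋯ × X_N` and a measure on `Y₁ × ⋯ × Y_N` is causal if
under it, for every `t`, `Y_{1:t}` is conditionally independent of `X_{t+1}` given `X_{1:t}`. -/
def IsCausal {X Y : Fin N → Type*} [∀ t, MeasurableSpace (X t)] [∀ t, MeasurableSpace (Y t)]
    (π : Measure ((∀ t, X t) × (∀ t, Y t))) : Prop :=
  IsCausalFor (coordσ X) (coordσ Y) π

def IsAnticausal {X Y : Fin N → Type*} [∀ t, MeasurableSpace (X t)] [∀ t, MeasurableSpace (Y t)]
    (π : Measure ((∀ t, X t) × (∀ t, Y t))) : Prop :=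
  IsAnticausalFor (coordσ X) (coordσ Y) π

def IsBicausal {X Y : Fin N → Type*} [∀ t, MeasurableSpace (X t)] [∀ t, MeasurableSpace (Y t)]
    (π : Measure ((∀ t, X t) × (∀ t, Y t))) : Prop :=
  IsCausal π ∧ IsAnticausal π

/-- `π` is a coupling of `μ` and `ν`. -/
def IsCoupling {A B : Type*} [MeasurableSpace A] [MeasurableSpace B]
    (μ : Measure A) (ν : Measure B) (π : Measure (A × B)) : Prop :=
  π.map Prod.fst = μ ∧ π.map Prod.snd = ν

/-- The four flavors of (adapted) optimal transport: plain, causal, anticausal, bicausal. -/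
inductive Flavor | plain | causal | anticausal | bicausal

/-- The adaptedness constraint corresponding to a flavor. -/
def IsAdapted {X Y : Fin N → Type*} [∀ t, MeasurableSpace (X t)] [∀ t, MeasurableSpace (Y t)] :
    Flavor → Measure ((∀ t, X t) × (∀ t, Y t)) → Prop
  | .plain => fun _ => True
  | .causal => fun π => IsCausal π
  | .anticausal => fun π => IsAnticausal π
  | .bicausal => fun π => IsBicausal π

/-- The set `Π_•(μ, ν)` of couplings of `μ` and `ν` with the adaptedness constraint
given by the flavor `b`. -/
def aCouplings {X Y : Fin N → Type*} [∀ t, MeasurableSpace (X t)] [∀ t, MeasurableSpace (Y t)]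
    (b : Flavor) (μ : Measure (∀ t, X t)) (ν : Measure (∀ t, Y t)) :
    Set (Measure ((∀ t, X t) × (∀ t, Y t))) :=
  {π | IsCoupling μ ν π ∧ IsAdapted b π}

/-- `p`-th power transport cost of a coupling. -/
def lcost (p : ℝ) {A : Type*} [MeasurableSpace A] [PseudoEMetricSpace A]
    (π : Measure (A × A)) : ℝ≥0∞ :=
  ∫⁻ z, edist z.1 z.2 ^ p ∂π

/-- The (adapted) Wasserstein distance `W_{p,•}` between two measures on a path space. -/
def W {X : Fin N → Type*} [∀ t, MeasurableSpace (X t)] [∀ t, PseudoEMetricSpace (X t)]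
    (p : ℝ) (b : Flavor) (μ ν : Measure (∀ t, X t)) : ℝ≥0∞ :=
  (⨅ π : aCouplings b μ ν, lcost p π.1) ^ (1 / p)

/-- Coordinate σ-algebras on `X × Y` viewed as a single path space with
coordinates `X_t × Y_t`. -/
def coordσ2 (X Y : Fin N → Type*) [∀ t, MeasurableSpace (X t)] [∀ t, MeasurableSpace (Y t)]
    (t : Fin N) : MeasurableSpace ((∀ s, X s) × (∀ s, Y s)) :=
  ((coordσ X t).comap Prod.fst) ⊔ ((coordσ Y t).comap Prod.snd)

/-- Adaptedness for measures on `(X × Y) × (X × Y)`, where `X × Y` is regarded as a single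
path space with `N` time steps, the `t`-th coordinate being `X_t × Y_t`. -/
def IsAdapted2 {X Y : Fin N → Type*} [∀ t, MeasurableSpace (X t)] [∀ t, MeasurableSpace (Y t)] :
    Flavor → Measure (((∀ t, X t) × (∀ t, Y t)) × ((∀ t, X t) × (∀ t, Y t))) → Prop
  | .plain => fun _ => True
  | .causal => fun θ => IsCausalFor (coordσ2 X Y) (coordσ2 X Y) θ
  | .anticausal => fun θ => IsAnticausalFor (coordσ2 X Y) (coordσ2 X Y) θ
  | .bicausal => fun θ => IsCausalFor (coordσ2 X Y) (coordσ2 X Y) θ ∧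
      IsAnticausalFor (coordσ2 X Y) (coordσ2 X Y) θ

/-- The set `Π_•(π, π̃)` of couplings of two measures on `X × Y`, with adaptedness understood
for `X × Y` as one path space. -/
def aCouplings2 {X Y : Fin N → Type*} [∀ t, MeasurableSpace (X t)] [∀ t, MeasurableSpace (Y t)]
    (b : Flavor) (π ρ : Measure ((∀ t, X t) × (∀ t, Y t))) :
    Set (Measure (((∀ t, X t) × (∀ t, Y t)) × ((∀ t, X t) × (∀ t, Y t)))) :=
  {θ | IsCoupling π ρ θ ∧ IsAdapted2 b θ}

/-- `p`-th power transport cost `∫ d_X(x,x̃)^p + d_Y(y,ỹ)^p dθ` for couplings of couplings. -/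
def lcost2 (p : ℝ) {A B : Type*} [MeasurableSpace A] [MeasurableSpace B]
    [PseudoEMetricSpace A] [PseudoEMetricSpace B]
    (θ : Measure ((A × B) × (A × B))) : ℝ≥0∞ :=
  ∫⁻ z, (edist z.1.1 z.2.1 ^ p + edist z.1.2 z.2.2 ^ p) ∂θ

/-- The (adapted) Wasserstein distance `W_{p,•}(π, π̃)` between couplings, with cost
`d_X^p + d_Y^p` and `X × Y` regarded as one path space. -/
def W2 {X Y : Fin N → Type*} [∀ t, MeasurableSpace (X t)] [∀ t, MeasurableSpace (Y t)]
    [∀ t, PseudoEMetricSpace (X t)] [∀ t, PseudoEMetricSpace (Y t)]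
    (p : ℝ) (b : Flavor) (π ρ : Measure ((∀ t, X t) × (∀ t, Y t))) : ℝ≥0∞ :=
  (⨅ θ : aCouplings2 b π ρ, lcost2 p θ.1) ^ (1 / p)

/- Relative entropy (Kullback-Leibler divergence): `D_KL(π, ρ) = ∫ log (dπ/dρ) dπ` if
`π ≪ ρ` and the integral is defined, and `∞` otherwise. -/
open Classical in
def KL {Ω : Type*} [MeasurableSpace Ω] (π ρ : Measure Ω) : ℝ≥0∞ :=
  if π ≪ ρ ∧ Integrable (llr π ρ) π then ENNReal.ofReal (∫ ω, llr π ρ ω ∂π) else ⊤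

/-- The transport value `V_•(μ, ν, c)`. -/
def V {X Y : Fin N → Type*} [∀ t, MeasurableSpace (X t)] [∀ t, MeasurableSpace (Y t)]
    (b : Flavor) (μ : Measure (∀ t, X t)) (ν : Measure (∀ t, Y t))
    (c : (∀ t, X t) × (∀ t, Y t) → ℝ) : ℝ :=
  ⨅ π : aCouplings b μ ν, ∫ z, c z ∂π.1

/-- The entropic objective `∫ c dπ + ε D_KL(π, P)`, valued in `EReal`. -/
def entObj {Ω : Type*} [MeasurableSpace Ω] (c : Ω → ℝ) (ε : ℝ) (P : Measure Ω)
    (π : Measure Ω) : EReal :=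
  ((∫ z, c z ∂π : ℝ) : EReal) + (ε : EReal) * ((KL π P : ℝ≥0∞) : EReal)

/-- The entropic transport value `E_•^ε(μ, ν, c)`, valued in `EReal`. -/
def EE {X Y : Fin N → Type*} [∀ t, MeasurableSpace (X t)] [∀ t, MeasurableSpace (Y t)]
    (b : Flavor) (μ : Measure (∀ t, X t)) (ν : Measure (∀ t, Y t))
    (c : (∀ t, X t) × (∀ t, Y t) → ℝ) (ε : ℝ) : EReal :=
  ⨅ π : aCouplings b μ ν, entObj c ε (μ.prod ν) π.1

/-- The kernel `K(x, y) := K^μ(x) ⊗ K^ν(y)` used to build the shadow. -/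
def shadowKernel {A A' B B' : Type*} [MeasurableSpace A] [MeasurableSpace A']
    [MeasurableSpace B] [MeasurableSpace B']
    (Kμ : Kernel A A') (Kν : Kernel B B') : Kernel (A × B) (A' × B') :=
  (Kμ.comap Prod.fst measurable_fst) ×ₖ (Kν.comap Prod.snd measurable_snd)

/-- The `(K^μ, K^ν)`-shadow of `π`: the second marginal of `π ⊗ (K^μ ⊗ K^ν)`. -/
def shadow {A A' B B' : Type*} [MeasurableSpace A] [MeasurableSpace A']
    [MeasurableSpace B] [MeasurableSpace B']
    (π : Measure (A × B)) (Kμ : Kernel A A') (Kν : Kernel B B') : Measure (A' × B') :=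
  (π ⊗ₘ (shadowKernel Kμ Kν)).map Prod.snd

/-- `μ` has a finite `p`-th moment. -/
def MemPp {A : Type*} [MeasurableSpace A] [PseudoEMetricSpace A] (p : ℝ) (μ : Measure A) :
    Prop :=
  ∀ x₀ : A, ∫⁻ x, edist x₀ x ^ p ∂μ ≠ ⊤

/-- `c` has growth of order at most `p`. -/
def GrowthLE {A B : Type*} [PseudoEMetricSpace A] [PseudoEMetricSpace B]
    (p : ℝ) (c : A × B → ℝ) : Prop :=
  ∃ (x₀ : A) (y₀ : B) (M : ℝ), ∀ z : A × B,
    |c z| ≤ M * (1 + (edist x₀ z.1).toReal ^ p + (edist y₀ z.2).toReal ^ p)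

/-- Weak convergence of a sequence of measures (testing against bounded continuous
functions). -/
def WeakTendsto {A : Type*} [MeasurableSpace A] [TopologicalSpace A]
    (πs : ℕ → Measure A) (π : Measure A) : Prop :=
  ∀ f : BoundedContinuousFunction A ℝ,
    Tendsto (fun n => ∫ x, f x ∂(πs n)) atTop (𝓝 (∫ x, f x ∂π))

/-- A finitely supported (discrete) measure. -/
def FinitelySupported {A : Type*} [MeasurableSpace A] (μ : Measure A) : Prop :=
  ∃ s : Finset A, μ (↑s)ᶜ = 0


/-- `K` is a version of the conditional distribution of the random element `V` given the
sub-σ-algebra `m`, under the measure `ρ`. -/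
def IsCondDistrib' {Ω E : Type*} {mΩ : MeasurableSpace Ω} [MeasurableSpace E]
    (ρ : @Measure Ω mΩ) (V : Ω → E) (m : MeasurableSpace Ω) (K : Ω → Measure E) : Prop :=
  (∀ ω, IsProbabilityMeasure (K ω)) ∧
  (∀ A : Set E, MeasurableSet A → Measurable[m] (fun ω => (K ω A).toReal)) ∧
  (∀ A : Set E, MeasurableSet A →
    (ρ[(V ⁻¹' A).indicator (fun _ => (1 : ℝ)) | m]) =ᵐ[ρ] fun ω => (K ω A).toReal)

/-- `Kμ` is a family of disintegration kernels of `μ` on a path space: `Kμ t` is a version of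
the conditional distribution of the `t`-th coordinate given the past before `t`. -/
def IsDisintegration {X : Fin N → Type*} [∀ t, MeasurableSpace (X t)]
    (μ : Measure (∀ t, X t)) (Kμ : ∀ t : Fin N, (∀ s, X s) → Measure (X t)) : Prop :=
  ∀ t : Fin N, IsCondDistrib' μ (fun x => x t) (pastσ X (t : ℕ)) (Kμ t)

variable {X Y : Fin N → Type*} [∀ t, MeasurableSpace (X t)] [∀ t, MeasurableSpace (Y t)]

open Classical in
/-- Membership in the dual building block `A_{X,μ,t}` (relative to a fixed family `Kμ` of
disintegration kernels of `μ`): for `t = 1` the bounded measurable functions of `x₁`; for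
`t ≥ 2` functions `a_t(x_{1:t}, y_{1:t-1}) - ∫ a_t(x_{1:t-1}, x̃_t, y_{1:t-1}) μ_t^{x_{1:t-1}}(dx̃_t)`
with `a_t` bounded measurable. (Here `τ` is the 0-based coordinate index, `τ = t - 1`.) -/
def MemAX (Kμ : ∀ t : Fin N, (∀ s, X s) → Measure (X t)) (τ : Fin N)
    (f : (∀ t, X t) × (∀ t, Y t) → ℝ) : Prop :=
  if (τ : ℕ) = 0 then
    ∃ a : (∀ t, X t) × (∀ t, Y t) → ℝ,
      Measurable[(coordσ X τ).comap Prod.fst] a ∧ (∃ M, ∀ ω, |a ω| ≤ M) ∧ f = a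
  else
    ∃ a : (∀ t, X t) × (∀ t, Y t) → ℝ,
      Measurable[((pastσ X (τ : ℕ) ⊔ coordσ X τ).comap Prod.fst) ⊔
        ((pastσ Y (τ : ℕ)).comap Prod.snd)] a ∧ (∃ M, ∀ ω, |a ω| ≤ M) ∧
      f = fun ω => a ω - ∫ x', a (Function.update ω.1 τ x', ω.2) ∂(Kμ τ ω.1)

open Classical in
/-- Membership in the dual building block `A_{Y,ν,t}` (symmetric to `MemAX`). -/
def MemAY (Kν : ∀ t : Fin N, (∀ s, Y s) → Measure (Y t)) (τ : Fin N)
    (f : (∀ t, X t) × (∀ t, Y t) → ℝ) : Prop :=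
  if (τ : ℕ) = 0 then
    ∃ a : (∀ t, X t) × (∀ t, Y t) → ℝ,
      Measurable[(coordσ Y τ).comap Prod.snd] a ∧ (∃ M, ∀ ω, |a ω| ≤ M) ∧ f = a
  else
    ∃ a : (∀ t, X t) × (∀ t, Y t) → ℝ,
      Measurable[((pastσ X (τ : ℕ)).comap Prod.fst) ⊔
        ((pastσ Y (τ : ℕ) ⊔ coordσ Y τ).comap Prod.snd)] a ∧ (∃ M, ∀ ω, |a ω| ≤ M) ∧
      f = fun ω => a ω - ∫ y', a (ω.1, Function.update ω.2 τ y') ∂(Kν τ ω.2)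

/-- The dual space `S_{X,μ}`: sums `∑_{t=1}^N f_t` with `f_t ∈ A_{X,μ,t}`. -/
def MemSXμ (Kμ : ∀ t : Fin N, (∀ s, X s) → Measure (X t))
    (s : (∀ t, X t) × (∀ t, Y t) → ℝ) : Prop :=
  ∃ f : Fin N → ((∀ t, X t) × (∀ t, Y t) → ℝ),
    (∀ τ, MemAX Kμ τ (f τ)) ∧ s = fun ω => ∑ τ, f τ ω

/-- The dual space `S_{Y,ν}`: sums `∑_{t=1}^N g_t` with `g_t ∈ A_{Y,ν,t}`. -/
def MemSYν (Kν : ∀ t : Fin N, (∀ s, Y s) → Measure (Y t))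
    (s : (∀ t, X t) × (∀ t, Y t) → ℝ) : Prop :=
  ∃ g : Fin N → ((∀ t, X t) × (∀ t, Y t) → ℝ),
    (∀ τ, MemAY Kν τ (g τ)) ∧ s = fun ω => ∑ τ, g τ ω

/-- The space `S_X` of bounded measurable functions depending only on `x`. -/
def MemSX (s : (∀ t, X t) × (∀ t, Y t) → ℝ) : Prop :=
  ∃ g : (∀ t, X t) → ℝ, Measurable g ∧ (∃ M, ∀ x, |g x| ≤ M) ∧ s = fun ω => g ω.1

/-- The space `S_Y` of bounded measurable functions depending only on `y`. -/
def MemSY (s : (∀ t, X t) × (∀ t, Y t) → ℝ) : Prop :=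
  ∃ g : (∀ t, Y t) → ℝ, Measurable g ∧ (∃ M, ∀ y, |g y| ≤ M) ∧ s = fun ω => g ω.2

/-- The dual space `H_•`: `H = S_X ⊕ S_Y`, `H_c = S_{X,μ} ⊕ S_Y`, `H_{ac} = S_X ⊕ S_{Y,ν}`,
`H_{bc} = S_{X,μ} ⊕ S_{Y,ν}`. -/
def MemH (Kμ : ∀ t : Fin N, (∀ s, X s) → Measure (X t))
    (Kν : ∀ t : Fin N, (∀ s, Y s) → Measure (Y t)) :
    Flavor → ((∀ t, X t) × (∀ t, Y t) → ℝ) → Prop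
  | .plain => fun h => ∃ sX sY, MemSX (X := X) (Y := Y) sX ∧ MemSY sY ∧
      h = fun ω => sX ω + sY ω
  | .causal => fun h => ∃ sX sY, MemSXμ Kμ sX ∧ MemSY sY ∧ h = fun ω => sX ω + sY ω
  | .anticausal => fun h => ∃ sX sY, MemSX (X := X) (Y := Y) sX ∧ MemSYν Kν sY ∧
      h = fun ω => sX ω + sY ω
  | .bicausal => fun h => ∃ sX sY, MemSXμ Kμ sX ∧ MemSYν Kν sY ∧ h = fun ω => sX ω + sY ω

/-- The set `Π_c(μ, ∗)` of causal measures with first marginal `μ` and arbitrary second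
marginal. -/
def causalFirst (μ : Measure (∀ t, X t)) : Set (Measure ((∀ t, X t) × (∀ t, Y t))) :=
  {π | π.map Prod.fst = μ ∧ IsCausal π}

/-- The set `Π(∗, ν)` of couplings with arbitrary first marginal and second marginal `ν`. -/
def secondMarg (ν : Measure (∀ t, Y t)) : Set (Measure ((∀ t, X t) × (∀ t, Y t))) :=
  {π | π.map Prod.snd = ν}

/-- The set `Π_{ac}(∗, ν)` of anticausal measures with second marginal `ν`. -/
def anticausalSecond (ν : Measure (∀ t, Y t)) : Set (Measure ((∀ t, X t) × (∀ t, Y t))) :=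
  {π | π.map Prod.snd = ν ∧ IsAnticausal π}

/-- The reference measure `P_c` with `dP_c/dP = exp(-c)/∫ exp(-c) dP`. -/
def Pc {Ω : Type*} [MeasurableSpace Ω] (P : Measure Ω) (c : Ω → ℝ) : Measure Ω :=
  P.withDensity
    (fun ω => ENNReal.ofReal (Real.exp (-c ω)) / ∫⁻ ω', ENNReal.ofReal (Real.exp (-c ω')) ∂P)

/-- Sinkhorn's algorithm: `full 0 = π0`; `half k` is the `D_KL`-projection of `full k`
onto `Q1`, and `full (k+1)` is the `D_KL`-projection of `half k` onto `Q2`. -/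
structure IsSinkhorn {Ω : Type*} [MeasurableSpace Ω] (Q1 Q2 : Set (Measure Ω))
    (π0 : Measure Ω) (full half : ℕ → Measure Ω) : Prop where
  init : full 0 = π0
  half_mem : ∀ k, half k ∈ Q1
  half_opt : ∀ k, ∀ ρ ∈ Q1, KL (half k) (full k) ≤ KL ρ (full k)
  full_mem : ∀ k, full (k + 1) ∈ Q2
  full_opt : ∀ k, ∀ ρ ∈ Q2, KL (full (k + 1)) (half k) ≤ KL ρ (half k)

/-- The second projection set of Sinkhorn's algorithm: `Π(∗, ν)` for the causal problem and
`Π_{ac}(∗, ν)` for the bicausal problem. -/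
def sinkQ2 (b : Flavor) (ν : Measure (∀ t, Y t)) : Set (Measure ((∀ t, X t) × (∀ t, Y t))) :=
  match b with
  | .bicausal => anticausalSecond ν
  | _ => secondMarg ν

/-- The dual class of the second Sinkhorn potential: `S_Y` for the causal problem,
`S_{Y,ν}` for the bicausal problem. -/
def MemG (Kν : ∀ t : Fin N, (∀ s, Y s) → Measure (Y t)) :
    Flavor → ((∀ t, X t) × (∀ t, Y t) → ℝ) → Prop
  | .bicausal => fun g => MemSYν Kν g
  | _ => fun g => MemSY g

/-- Real-valued entropic transport value (`ε = 1`), the infimum being taken over couplings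
with finite relative entropy. -/
def Efin (b : Flavor) (μ : Measure (∀ t, X t)) (ν : Measure (∀ t, Y t))
    (c : (∀ t, X t) × (∀ t, Y t) → ℝ) : ℝ :=
  ⨅ π : {π : Measure ((∀ t, X t) × (∀ t, Y t)) //
      π ∈ aCouplings b μ ν ∧ KL π (μ.prod ν) ≠ ⊤},
    (∫ z, c z ∂π.1 + (KL π.1 (μ.prod ν)).toReal)

/-- `a` is a version of the conditional probability of `A` given `m`, with values in `ℝ≥0∞`. -/
structure IsCondProb {Ω : Type*} {mΩ : MeasurableSpace Ω} (π : @Measure Ω mΩ)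
    (m : MeasurableSpace Ω) (A : Set Ω) (a : Ω → ℝ≥0∞) : Prop where
  measurable : Measurable[m] a
  setLIntegral_eq : ∀ D, MeasurableSet[m] D → ∫⁻ ω in D, a ω ∂π = π (A ∩ D)

section CondProb

variable {Ω : Type*} {m mΩ : MeasurableSpace Ω} {π : Measure Ω} {A : Set Ω} {a : Ω → ℝ≥0∞}

/-- A density of `ρ` with respect to `π` on a sub-σ-algebra. -/
lemma exists_measurable_setLIntegral_eq {ρ : Measure Ω} [IsFiniteMeasure ρ] [IsFiniteMeasure π]
    (hm : m ≤ mΩ) (h : ρ ≪ π) :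
    ∃ g : Ω → ℝ≥0∞, Measurable[m] g ∧ ∀ D, MeasurableSet[m] D → ∫⁻ ω in D, g ω ∂π = ρ D := by
  have hac : ρ.trim hm ≪ π.trim hm := by
    refine Measure.AbsolutelyContinuous.mk fun s hs h0 => ?_
    rw [trim_measurableSet_eq hm hs] at h0 ⊢
    exact h h0
  refine ⟨(ρ.trim hm).rnDeriv (π.trim hm), Measure.measurable_rnDeriv _ _, fun D hD => ?_⟩
  rw [← lintegral_trim hm (Measure.measurable_rnDeriv _ _), ← restrict_trim hm π hD,
    Measure.setLIntegral_rnDeriv hac, trim_measurableSet_eq hm hD]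

lemma exists_isCondProb [IsFiniteMeasure π] (hm : m ≤ mΩ) (A : Set Ω) :
    ∃ a, IsCondProb π m A a := by
  obtain ⟨a, ha, h⟩ := exists_measurable_setLIntegral_eq (ρ := π.restrict A) hm
    Measure.restrict_le_self.absolutelyContinuous
  exact ⟨a, ha, fun D hD => by rw [h D hD, Measure.restrict_apply (hm _ hD), inter_comm]⟩

/-- Measures agreeing on a sub-σ-algebra integrate its measurable functions alike. -/
lemma setLIntegral_congr_of_eq_on {ρ₁ ρ₂ : Measure Ω} (hm : m ≤ mΩ)
    (h : ∀ E, MeasurableSet[m] E → ρ₁ E = ρ₂ E) {f : Ω → ℝ≥0∞} (hf : Measurable[m] f)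
    {D : Set Ω} (hD : MeasurableSet[m] D) : ∫⁻ ω in D, f ω ∂ρ₁ = ∫⁻ ω in D, f ω ∂ρ₂ := by
  have hT : ρ₁.trim hm = ρ₂.trim hm := by
    refine @Measure.ext _ m _ _ fun E hE => ?_
    rw [trim_measurableSet_eq hm hE, trim_measurableSet_eq hm hE, h E hE]
  rw [← lintegral_indicator (hm _ hD), ← lintegral_indicator (hm _ hD),
    ← lintegral_trim hm (hf.indicator hD), ← lintegral_trim hm (hf.indicator hD), hT]

/-- Finite measures agreeing on intersections agree on the generated σ-algebra. -/
lemma measure_eq_of_eq_on_inter {m₁ m₂ : MeasurableSpace Ω} {ρ₁ ρ₂ : @Measure Ω mΩ}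
    [IsFiniteMeasure ρ₁] (hm₁ : m₁ ≤ mΩ) (hm₂ : m₂ ≤ mΩ)
    (h : ∀ A D, MeasurableSet[m₁] A → MeasurableSet[m₂] D → ρ₁ (A ∩ D) = ρ₂ (A ∩ D))
    {E : Set Ω} (hE : MeasurableSet[m₁ ⊔ m₂] E) : ρ₁ E = ρ₂ E := by
  have hm : m₁ ⊔ m₂ ≤ mΩ := sup_le hm₁ hm₂
  let C : Set (Set Ω) := {s | ∃ A D, MeasurableSet[m₁] A ∧ MeasurableSet[m₂] D ∧ s = A ∩ D}
  have hgen : m₁ ⊔ m₂ = MeasurableSpace.generateFrom C := by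
    refine le_antisymm (sup_le ?_ ?_) (MeasurableSpace.generateFrom_le ?_)
    · exact fun A hA => MeasurableSpace.measurableSet_generateFrom
        ⟨A, univ, hA, MeasurableSet.univ, (inter_univ _).symm⟩
    · exact fun D hD => MeasurableSpace.measurableSet_generateFrom
        ⟨univ, D, MeasurableSet.univ, hD, (univ_inter _).symm⟩
    · rintro _ ⟨A, D, hA, hD, rfl⟩
      exact MeasurableSet.inter (le_sup_left (a := m₁) (b := m₂) _ hA)
        (le_sup_right (a := m₁) (b := m₂) _ hD)
  have hpi : IsPiSystem C := by
    rintro _ ⟨A, D, hA, hD, rfl⟩ _ ⟨A', D', hA', hD', rfl⟩ _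
    exact ⟨A ∩ A', D ∩ D', MeasurableSet.inter hA hA', MeasurableSet.inter hD hD',
      inter_inter_inter_comm _ _ _ _⟩
  have huniv : ρ₁ univ = ρ₂ univ := by
    simpa using h univ univ MeasurableSet.univ MeasurableSet.univ
  have hT : ρ₁.trim hm = ρ₂.trim hm := by
    refine ext_of_generate_finite C hgen hpi ?_ ?_
    · rintro _ ⟨A, D, hA, hD, rfl⟩
      have hAD := MeasurableSet.inter (le_sup_left (a := m₁) (b := m₂) _ hA)
        (le_sup_right (a := m₁) (b := m₂) _ hD)
      rw [trim_measurableSet_eq hm hAD, trim_measurableSet_eq hm hAD, h A D hA hD]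
    · rw [trim_measurableSet_eq hm MeasurableSet.univ, trim_measurableSet_eq hm MeasurableSet.univ,
        huniv]
  rw [← trim_measurableSet_eq hm hE, ← trim_measurableSet_eq hm hE, hT]

lemma IsCondProb.comp {Ω' : Type*} {mΩ' : MeasurableSpace Ω'} {f : Ω' → Ω} {ρ : Measure Ω'}
    (hf : Measurable f) (hm : m ≤ mΩ) (hA : MeasurableSet A)
    (h : IsCondProb (ρ.map f) m A a) : IsCondProb ρ (m.comap f) (f ⁻¹' A) (a ∘ f) := by
  refine ⟨h.measurable.comp (comap_measurable f), ?_⟩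
  rintro _ ⟨D, hD, rfl⟩
  rw [← preimage_inter, ← Measure.map_apply hf (hA.inter (hm _ hD)), ← h.setLIntegral_eq D hD,
    setLIntegral_map (hm _ hD) (h.measurable.mono hm le_rfl) hf]
  rfl

lemma IsCondProb.lintegral_ne_top [IsFiniteMeasure π] (h : IsCondProb π m A a) :
    ∫⁻ ω, a ω ∂π ≠ ∞ := by
  have := h.setLIntegral_eq univ MeasurableSet.univ
  rw [Measure.restrict_univ] at this
  rw [this]
  exact measure_ne_top _ _

lemma IsCondProb.integrable_toReal [IsFiniteMeasure π] (hm : m ≤ mΩ) (h : IsCondProb π m A a) :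
    Integrable (fun ω => (a ω).toReal) π :=
  integrable_toReal_of_lintegral_ne_top (h.measurable.mono hm le_rfl).aemeasurable
    h.lintegral_ne_top

lemma IsCondProb.ae_lt_top [IsFiniteMeasure π] (hm : m ≤ mΩ) (h : IsCondProb π m A a) :
    ∀ᵐ ω ∂π, a ω < ∞ :=
  MeasureTheory.ae_lt_top (h.measurable.mono hm le_rfl) h.lintegral_ne_top

lemma IsCondProb.setIntegral_toReal [IsFiniteMeasure π] (hm : m ≤ mΩ) (h : IsCondProb π m A a)
    (s : Set Ω) : ∫ ω in s, (a ω).toReal ∂π = (∫⁻ ω in s, a ω ∂π).toReal :=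
  integral_toReal (h.measurable.mono hm le_rfl).aemeasurable
    (ae_restrict_of_ae (h.ae_lt_top hm))

lemma IsCondProb.toReal_ae_eq_condExp [IsFiniteMeasure π] (hm : m ≤ mΩ) (hA : MeasurableSet A)
    (h : IsCondProb π m A a) :
    (fun ω => (a ω).toReal) =ᵐ[π] π[A.indicator (fun _ => (1 : ℝ)) | m] := by
  refine ae_eq_condExp_of_forall_setIntegral_eq hm ((integrable_const _).indicator hA)
    (fun s _ _ => (h.integrable_toReal hm).integrableOn) (fun s hs _ => ?_)
    (h.measurable.ennreal_toReal.stronglyMeasurable.aestronglyMeasurable)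
  rw [h.setIntegral_toReal hm, h.setLIntegral_eq s hs, integral_indicator hA]
  simp [measureReal_def, hA]

lemma condExp_indicator_mul [IsProbabilityMeasure π] {A B : Set Ω} (hA : MeasurableSet A)
    (hB : MeasurableSet B) (hm : m ≤ mΩ) (ha : IsCondProb π m A a) :
    (π[A.indicator (fun _ => (1 : ℝ)) | m]) * (π[B.indicator (fun _ => (1 : ℝ)) | m]) =ᵐ[π]
      π[B.indicator (fun ω => (a ω).toReal) | m] := by
  have h1 : (fun ω => (a ω).toReal) * B.indicator (fun _ => (1 : ℝ)) =
      B.indicator (fun ω => (a ω).toReal) := by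
    ext ω
    by_cases hω : ω ∈ B <;> simp [hω]
  have h2 := condExp_mul_of_stronglyMeasurable_left (m := m) (μ := π)
    (f := fun ω => (a ω).toReal) (g := B.indicator (fun _ => (1 : ℝ)))
    ha.measurable.ennreal_toReal.stronglyMeasurable
    (by rw [h1]; exact (ha.integrable_toReal hm).indicator hB)
    ((integrable_const _).indicator hB)
  rw [h1] at h2
  filter_upwards [h2, ha.toReal_ae_eq_condExp hm hA] with ω h3 h4
  rw [h3, Pi.mul_apply, Pi.mul_apply, h4]

lemma setIntegral_indicator_inter [IsProbabilityMeasure π] {A B D : Set Ω} (hA : MeasurableSet A)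
    (hB : MeasurableSet B) :
    ∫ ω in D, (A ∩ B).indicator (fun _ => (1 : ℝ)) ω ∂π = (π (A ∩ D ∩ B)).toReal := by
  have hAB : MeasurableSet[mΩ] (A ∩ B) := hA.inter hB
  rw [integral_indicator hAB]
  simp only [integral_const, smul_eq_mul, mul_one, measureReal_def,
    Measure.restrict_apply MeasurableSet.univ, univ_inter]
  rw [Measure.restrict_apply hAB, inter_right_comm]

lemma setIntegral_indicator_toReal [IsProbabilityMeasure π] {A B D : Set Ω}
    (hB : MeasurableSet B) (hm : m ≤ mΩ) (ha : IsCondProb π m A a) :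
    ∫ ω in D, B.indicator (fun ω => (a ω).toReal) ω ∂π = (∫⁻ ω in D ∩ B, a ω ∂π).toReal := by
  rw [setIntegral_indicator hB, ha.setIntegral_toReal hm]

variable {m₁ m₂ : MeasurableSpace Ω}

/-- Under conditional independence, conditional probabilities integrate correctly over sets of
the second σ-algebra. -/
lemma CondIndepσ.measure_inter_eq [IsProbabilityMeasure π] (h : CondIndepσ m₁ m₂ m π)
    (hm₁ : m₁ ≤ mΩ) (hm₂ : m₂ ≤ mΩ) (hm : m ≤ mΩ) {A B D : Set Ω} (hA : MeasurableSet[m₁] A)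
    (hB : MeasurableSet[m₂] B) (hD : MeasurableSet[m] D) (ha : IsCondProb π m A a) :
    π (A ∩ D ∩ B) = ∫⁻ ω in D ∩ B, a ω ∂π := by
  have h1 := (h A B hA hB).trans (condExp_indicator_mul (hm₁ _ hA) (hm₂ _ hB) hm ha)
  have h2 : ∫ ω in D, (A ∩ B).indicator (fun _ => (1 : ℝ)) ω ∂π =
      ∫ ω in D, B.indicator (fun ω => (a ω).toReal) ω ∂π := by
    rw [← setIntegral_condExp hm ((integrable_const _).indicator
        ((hm₁ _ hA).inter (hm₂ _ hB))) hD,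
      ← setIntegral_condExp hm ((ha.integrable_toReal hm).indicator (hm₂ _ hB)) hD]
    exact integral_congr_ae (ae_restrict_of_ae h1)
  rw [setIntegral_indicator_inter (hm₁ _ hA) (hm₂ _ hB),
    setIntegral_indicator_toReal (hm₂ _ hB) hm ha] at h2
  exact (ENNReal.toReal_eq_toReal_iff' (measure_ne_top _ _)
    (ne_top_of_le_ne_top ha.lintegral_ne_top (setLIntegral_le_lintegral _ _))).1 h2

lemma condIndepσ_of_exists_isCondProb [IsProbabilityMeasure π] (hm₁ : m₁ ≤ mΩ) (hm₂ : m₂ ≤ mΩ)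
    (hm : m ≤ mΩ)
    (h : ∀ A, MeasurableSet[m₁] A → ∃ a, IsCondProb π m A a ∧ ∀ B D, MeasurableSet[m₂] B →
      MeasurableSet[m] D → π (A ∩ D ∩ B) = ∫⁻ ω in D ∩ B, a ω ∂π) : CondIndepσ m₁ m₂ m π := by
  intro A B hA hB
  obtain ⟨a, ha, h⟩ := h A hA
  refine EventuallyEq.trans (EventuallyEq.symm ?_)
    (condExp_indicator_mul (hm₁ _ hA) (hm₂ _ hB) hm ha).symm
  refine ae_eq_condExp_of_forall_setIntegral_eq hm
    ((integrable_const _).indicator ((hm₁ _ hA).inter (hm₂ _ hB)))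
    (fun s _ _ => integrable_condExp.integrableOn) (fun D hD _ => ?_)
    stronglyMeasurable_condExp.aestronglyMeasurable
  rw [setIntegral_condExp hm ((ha.integrable_toReal hm).indicator (hm₂ _ hB)) hD,
    setIntegral_indicator_inter (hm₁ _ hA) (hm₂ _ hB),
    setIntegral_indicator_toReal (hm₂ _ hB) hm ha, h B D hB hD]

end CondProb

section PathSpace

variable {N : ℕ} {X Y : Fin N → Type*} [∀ t, MeasurableSpace (X t)] [∀ t, MeasurableSpace (Y t)]

lemma coordσ_le (t : Fin N) : coordσ X t ≤ MeasurableSpace.pi :=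
  (measurable_pi_apply t).comap_le

lemma pastσ_le (t : ℕ) : pastσ X t ≤ MeasurableSpace.pi :=
  iSup₂_le fun s _ => coordσ_le s

lemma pastσ_mono {s t : ℕ} (h : s ≤ t) : pastσ X s ≤ pastσ X t :=
  iSup₂_le fun r hr => le_iSup₂_of_le r (lt_of_lt_of_le hr h) le_rfl

lemma coordσ_le_pastσ {s : Fin N} {t : ℕ} (h : (s : ℕ) < t) : coordσ X s ≤ pastσ X t :=
  le_iSup₂_of_le (f := fun (s : Fin N) (_ : (s : ℕ) < t) => coordσ X s) s h le_rfl

lemma pastσ_succ_le (s : Fin N) : pastσ X (s + 1) ≤ coordσ X s ⊔ pastσ X s := by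
  refine iSup₂_le fun r hr => ?_
  rcases (Nat.lt_succ_iff_lt_or_eq.1 hr) with h | h
  · exact le_sup_of_le_right (coordσ_le_pastσ h)
  · rw [Fin.ext h]
    exact le_sup_left

lemma pi_le_pastσ {t : ℕ} (h : N ≤ t) : MeasurableSpace.pi ≤ pastσ X t :=
  iSup_le fun s => coordσ_le_pastσ (s.2.trans_le h)

lemma pastσ_succ_le_of_le {t : ℕ} (h : N ≤ t) : pastσ X (t + 1) ≤ pastσ X t :=
  (pastσ_le _).trans (pi_le_pastσ h)

/-- Causality in terms of versions of the conditional probabilities of the first marginal `μ`. -/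
def CausalTest (μ : Measure (∀ t, X t)) (π : Measure ((∀ t, X t) × (∀ t, Y t))) : Prop :=
  ∀ (t : Fin N) (A D : Set (∀ t, X t)) (B : Set (∀ t, Y t)) (a : (∀ t, X t) → ℝ≥0∞),
    MeasurableSet[coordσ X t] A → MeasurableSet[pastσ X t] D → MeasurableSet[pastσ Y t] B →
    IsCondProb μ (pastσ X t) A a → π ((A ∩ D) ×ˢ B) = ∫⁻ z in D ×ˢ B, a z.1 ∂π

/-- Causality in dual form: conditional expectations of functions of the past of `y` given `x`
only depend on the past of `x`. -/
def CausalDual (π : Measure ((∀ t, X t) × (∀ t, Y t))) : Prop :=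
  ∀ (t : Fin N) (h : (∀ t, Y t) → ℝ≥0∞), Measurable[pastσ Y t] h →
    ∃ g : (∀ t, X t) → ℝ≥0∞, Measurable[pastσ X t] g ∧ ∀ φ : (∀ t, X t) → ℝ≥0∞, Measurable φ →
      ∫⁻ z, h z.2 * φ z.1 ∂π = ∫⁻ z, g z.1 * φ z.1 ∂π

variable {μ : Measure (∀ t, X t)} {π : Measure ((∀ t, X t) × (∀ t, Y t))}

lemma causalTest_of_isCausal [IsProbabilityMeasure π] (h : IsCausal π) :
    CausalTest (π.map Prod.fst) π := by
  intro t A D B a hA hD hB ha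
  have h1 := (h t).measure_inter_eq
    ((MeasurableSpace.comap_mono (coordσ_le t)).trans measurable_fst.comap_le)
    ((MeasurableSpace.comap_mono (pastσ_le t)).trans measurable_snd.comap_le)
    ((MeasurableSpace.comap_mono (pastσ_le t)).trans measurable_fst.comap_le)
    ⟨A, hA, rfl⟩ ⟨B, hB, rfl⟩ ⟨D, hD, rfl⟩
    (ha.comp measurable_fst (pastσ_le t) (coordσ_le t _ hA))
  rwa [← preimage_inter, ← Set.prod_eq, ← Set.prod_eq] at h1

lemma isCausal_of_causalTest [IsProbabilityMeasure π] (h : CausalTest (π.map Prod.fst) π) :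
    IsCausal π := by
  intro t
  refine condIndepσ_of_exists_isCondProb
    ((MeasurableSpace.comap_mono (coordσ_le t)).trans measurable_fst.comap_le)
    ((MeasurableSpace.comap_mono (pastσ_le t)).trans measurable_snd.comap_le)
    ((MeasurableSpace.comap_mono (pastσ_le t)).trans measurable_fst.comap_le) ?_
  rintro _ ⟨A, hA, rfl⟩
  have : IsProbabilityMeasure (π.map Prod.fst) :=
    Measure.isProbabilityMeasure_map measurable_fst.aemeasurable
  obtain ⟨a, ha⟩ := exists_isCondProb (π := π.map Prod.fst) (pastσ_le (X := X) t) A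
  refine ⟨a ∘ Prod.fst, ha.comp measurable_fst (pastσ_le t) (coordσ_le t _ hA), ?_⟩
  rintro _ _ ⟨B, hB, rfl⟩ ⟨D, hD, rfl⟩
  have h1 := h t A D B a hA hD hB ha
  rwa [Set.prod_eq, Set.prod_eq, preimage_inter] at h1

lemma IsCondProb.setLIntegral_mul_eq {Ω : Type*} {m mΩ : MeasurableSpace Ω}
    {μ : Measure Ω} {A D : Set Ω} {a g : Ω → ℝ≥0∞} (hm : m ≤ mΩ)
    (ha : IsCondProb μ m A a) (hg : Measurable[m] g) (hD : MeasurableSet[m] D) :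
    ∫⁻ x in D, a x * g x ∂μ = ∫⁻ x in A ∩ D, g x ∂μ := by
  have hm' := ha.measurable.mono hm le_rfl
  have h := setLIntegral_congr_of_eq_on (ρ₁ := μ.withDensity a) (ρ₂ := μ.restrict A) hm
    (fun E hE => by
      rw [withDensity_apply _ (hm _ hE), ha.setLIntegral_eq E hE,
        Measure.restrict_apply (hm _ hE), inter_comm]) hg hD
  rw [restrict_withDensity (hm _ hD), lintegral_withDensity_eq_lintegral_mul _ hm'
    (hg.mono hm le_rfl), Measure.restrict_restrict (hm _ hD), inter_comm] at h
  exact h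

lemma causalTest_of_causalDual (h : CausalDual π) : CausalTest (π.map Prod.fst) π := by
  intro t A D B a hA hD hB ha
  have hA' := coordσ_le t _ hA
  have hD' := pastσ_le t _ hD
  have hB' := pastσ_le t _ hB
  have ha' := ha.measurable.mono (pastσ_le t) le_rfl
  obtain ⟨g, hg, hgφ⟩ := h t (B.indicator fun _ => 1) (measurable_const.indicator hB)
  have hg' := hg.mono (pastσ_le t) le_rfl
  have e1 : π ((A ∩ D) ×ˢ B) =
      ∫⁻ z, B.indicator (fun _ => 1) z.2 * (A ∩ D).indicator (fun _ => 1) z.1 ∂π := by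
    rw [← lintegral_indicator_one ((hA'.inter hD').prod hB')]
    refine lintegral_congr fun z => ?_
    by_cases h1 : z.1 ∈ A ∩ D <;> by_cases h2 : z.2 ∈ B <;>
      simp [indicator, mem_prod, h1, h2, -mem_inter_iff]
  have e2 : ∫⁻ z in D ×ˢ B, a z.1 ∂π =
      ∫⁻ z, B.indicator (fun _ => 1) z.2 * D.indicator a z.1 ∂π := by
    rw [← lintegral_indicator (hD'.prod hB')]
    refine lintegral_congr fun z => ?_
    by_cases h1 : z.1 ∈ D <;> by_cases h2 : z.2 ∈ B <;> simp [indicator, mem_prod, h1, h2]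
  rw [e1, e2, hgφ _ (measurable_const.indicator (hA'.inter hD')), hgφ _ (ha'.indicator hD')]
  have e3 := ha.setLIntegral_mul_eq (pastσ_le t) hg hD
  rw [← lintegral_indicator hD', ← lintegral_indicator (hA'.inter hD'),
    lintegral_map (Measurable.indicator (by fun_prop) hD') measurable_fst,
    lintegral_map (hg'.indicator (hA'.inter hD')) measurable_fst] at e3
  convert e3.symm using 2
  · ext z
    by_cases h1 : z.1 ∈ A ∩ D <;> simp [h1]
  · ext z
    by_cases h1 : z.1 ∈ D <;> simp [h1, mul_comm]

lemma causalDual_indicator [IsProbabilityMeasure π] (h : CausalTest (π.map Prod.fst) π)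
    {t : Fin N} {B : Set (∀ t, Y t)} (hB : MeasurableSet[pastσ Y t] B) :
    ∃ g : (∀ t, X t) → ℝ≥0∞, Measurable[pastσ X t] g ∧ ∀ φ : (∀ t, X t) → ℝ≥0∞, Measurable φ →
      ∫⁻ z, B.indicator (fun _ => 1) z.2 * φ z.1 ∂π = ∫⁻ z, g z.1 * φ z.1 ∂π := by
  have hB' := pastσ_le t _ hB
  have hpB : MeasurableSet (Prod.snd ⁻¹' B : Set ((∀ t, X t) × (∀ t, Y t))) := measurable_snd hB'
  let ρ := (π.restrict (Prod.snd ⁻¹' B)).map Prod.fst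
  have hρ : ρ ≪ π.map Prod.fst :=
    (Measure.restrict_le_self.absolutelyContinuous).map measurable_fst
  obtain ⟨g, hg, hgρ⟩ := exists_measurable_setLIntegral_eq (pastσ_le (X := X) t) hρ
  have hg' := hg.mono (pastσ_le t) le_rfl
  have hρint : ∀ (D : Set (∀ t, X t)) (f : (∀ t, X t) → ℝ≥0∞), MeasurableSet D → Measurable f →
      ∫⁻ x in D, f x ∂ρ = ∫⁻ z in D ×ˢ B, f z.1 ∂π := by
    intro D f hD hf
    rw [setLIntegral_map hD hf measurable_fst, Measure.restrict_restrict (measurable_fst hD),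
      Set.prod_eq]
  have hclaim : ∀ s : ℕ, (t : ℕ) ≤ s → ∀ E, MeasurableSet[pastσ X s] E →
      ρ E = (π.map Prod.fst).withDensity g E := by
    intro s hs
    induction s, hs using Nat.le_induction with
    | base =>
      intro E hE
      rw [withDensity_apply _ (pastσ_le _ _ hE), hgρ E hE]
    | succ s hs ih =>
      intro E hE
      rcases le_or_gt N s with hNs | hsN
      · exact ih E (pastσ_succ_le_of_le hNs _ hE)
      · let s' : Fin N := ⟨s, hsN⟩
        refine measure_eq_of_eq_on_inter (coordσ_le s') (pastσ_le s) (fun A D hA hD => ?_)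
          (pastσ_succ_le s' _ hE)
        have hA' := coordσ_le s' _ hA
        have hD' := pastσ_le s _ hD
        obtain ⟨a, ha⟩ := exists_isCondProb (π := π.map Prod.fst) (pastσ_le (X := X) s) A
        have ha' := ha.measurable.mono (pastσ_le s) le_rfl
        have h1 : ρ (A ∩ D) = π ((A ∩ D) ×ˢ B) := by
          rw [Measure.map_apply measurable_fst (hA'.inter hD'),
            Measure.restrict_apply (measurable_fst (hA'.inter hD')), Set.prod_eq]
        rw [h1, h s' A D B a hA hD (pastσ_mono hs _ hB) ha, ← hρint D a hD' ha',
          setLIntegral_congr_of_eq_on (pastσ_le s) ih ha.measurable hD,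
          restrict_withDensity hD', lintegral_withDensity_eq_lintegral_mul _ hg' ha',
          withDensity_apply _ (hA'.inter hD'),
          ← ha.setLIntegral_mul_eq (pastσ_le s) (hg.mono (pastσ_mono hs) le_rfl) hD]
        simp [mul_comm]
  have hρeq : ρ = (π.map Prod.fst).withDensity g :=
    Measure.ext fun E hE => hclaim N t.2.le E (pi_le_pastσ le_rfl _ hE)
  refine ⟨g, hg, fun φ hφ => ?_⟩
  have h1 := hρint univ φ MeasurableSet.univ hφ
  rw [Measure.restrict_univ, hρeq, lintegral_withDensity_eq_lintegral_mul _ hg' hφ,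
    lintegral_map (hg'.mul hφ) measurable_fst] at h1
  refine Eq.trans ?_ h1.symm
  rw [univ_prod, ← lintegral_indicator hpB]
  refine lintegral_congr fun z => ?_
  by_cases h2 : z.2 ∈ B <;> simp [h2]

lemma causalDual_of_causalTest [IsProbabilityMeasure π] (h : CausalTest (π.map Prod.fst) π) :
    CausalDual π := by
  intro t f hf
  refine @Measurable.ennreal_induction _ (pastσ Y t) (fun f => ∃ g : (∀ t, X t) → ℝ≥0∞,
    Measurable[pastσ X t] g ∧ ∀ φ : (∀ t, X t) → ℝ≥0∞, Measurable φ →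
      ∫⁻ z, f z.2 * φ z.1 ∂π = ∫⁻ z, g z.1 * φ z.1 ∂π) ?_ ?_ ?_ f hf
  · intro c B hB
    obtain ⟨g, hg, hgφ⟩ := causalDual_indicator h hB
    refine ⟨fun x => c * g x, hg.const_mul c, fun φ hφ => ?_⟩
    have hB' := pastσ_le t _ hB
    have hg' := hg.mono (pastσ_le t) le_rfl
    have e : ∀ z : (∀ t, X t) × (∀ t, Y t), B.indicator (fun _ => c) z.2 * φ z.1 =
        c * (B.indicator (fun _ => 1) z.2 * φ z.1) := by
      intro z
      by_cases h2 : z.2 ∈ B <;> simp [h2]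
    simp_rw [e, mul_assoc]
    rw [lintegral_const_mul, lintegral_const_mul, hgφ φ hφ]
    · exact (hg'.comp measurable_fst).mul (hφ.comp measurable_fst)
    · exact ((measurable_const.indicator hB').comp measurable_snd).mul (hφ.comp measurable_fst)
  · intro f₁ f₂ _ hf₁ hf₂ ih₁ ih₂
    obtain ⟨g₁, hg₁, h₁⟩ := ih₁
    obtain ⟨g₂, hg₂, h₂⟩ := ih₂
    refine ⟨g₁ + g₂, hg₁.add hg₂, fun φ hφ => ?_⟩
    have hφ' : Measurable fun z : (∀ t, X t) × (∀ t, Y t) => φ z.1 := hφ.comp measurable_fst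
    simp_rw [Pi.add_apply, add_mul]
    rw [lintegral_add_left, lintegral_add_left, h₁ φ hφ, h₂ φ hφ]
    · exact ((hg₁.mono (pastσ_le t) le_rfl).comp measurable_fst).mul hφ'
    · exact ((hf₁.mono (pastσ_le t) le_rfl).comp measurable_snd).mul hφ'
  · intro f hf hmono ih
    choose g hg hgφ using ih
    have hg' := fun n => (hg n).mono (pastσ_le t) le_rfl
    have hf' := fun n => (hf n).mono (pastσ_le t) le_rfl
    refine ⟨fun x => ⨆ n, g n x, Measurable.iSup hg, fun φ hφ => ?_⟩
    have hφ' : Measurable fun z : (∀ t, X t) × (∀ t, Y t) => φ z.1 := hφ.comp measurable_fst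
    have hle : ∀ n, g n ≤ᵐ[π.map Prod.fst] g (n + 1) := by
      intro n
      refine ae_le_of_forall_setLIntegral_le_of_sigmaFinite (hg' n) fun s hs _ => ?_
      have e : ∀ n, ∫⁻ x in s, g n x ∂(π.map Prod.fst) =
          ∫⁻ z, f n z.2 * s.indicator (fun _ => 1) z.1 ∂π := by
        intro n
        rw [hgφ n _ (measurable_const.indicator hs), ← lintegral_indicator hs,
          lintegral_map ((hg' n).indicator hs) measurable_fst]
        refine lintegral_congr fun z => ?_
        by_cases h2 : z.1 ∈ s <;> simp [h2]
      rw [e, e]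
      exact lintegral_mono fun z => mul_le_mul_left (hmono n.le_succ z.2) _
    simp_rw [ENNReal.iSup_mul]
    rw [lintegral_iSup, lintegral_iSup_ae]
    · exact iSup_congr fun n => hgφ n φ hφ
    · exact fun n => ((hg' n).comp measurable_fst).mul hφ'
    · intro n
      filter_upwards [ae_of_ae_map measurable_fst.aemeasurable (hle n)] with z hz
      exact mul_le_mul_left hz _
    · exact fun n => ((hf' n).comp measurable_snd).mul hφ'
    · exact fun m n hmn z => mul_le_mul_left (hmono hmn z.2) _

lemma isCausal_iff_causalTest [IsProbabilityMeasure π] :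
    IsCausal π ↔ CausalTest (π.map Prod.fst) π :=
  ⟨causalTest_of_isCausal, isCausal_of_causalTest⟩

lemma isCausal_iff_causalDual [IsProbabilityMeasure π] : IsCausal π ↔ CausalDual π :=
  ⟨fun h => causalDual_of_causalTest (causalTest_of_isCausal h),
    fun h => isCausal_of_causalTest (causalTest_of_causalDual h)⟩

end PathSpace

section Shadow

variable {A A' B B' : Type*} [MeasurableSpace A] [MeasurableSpace A'] [MeasurableSpace B]
  [MeasurableSpace B'] {π : Measure (A × B)} {K : Kernel A A'} {L : Kernel B B'}

instance [IsMarkovKernel K] [IsMarkovKernel L] : IsMarkovKernel (shadowKernel K L) := by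
  unfold shadowKernel
  infer_instance

instance [IsProbabilityMeasure π] [IsMarkovKernel K] [IsMarkovKernel L] :
    IsProbabilityMeasure (shadow π K L) :=
  Measure.isProbabilityMeasure_map measurable_snd.aemeasurable

lemma shadowKernel_apply [IsMarkovKernel K] [IsMarkovKernel L] (z : A × B) :
    shadowKernel K L z = (K z.1).prod (L z.2) := by
  rw [shadowKernel, Kernel.prod_apply, Kernel.comap_apply, Kernel.comap_apply]

lemma lintegral_shadow [SFinite π] [IsMarkovKernel K] [IsMarkovKernel L] {f : A' × B' → ℝ≥0∞}
    (hf : Measurable f) :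
    ∫⁻ w, f w ∂shadow π K L = ∫⁻ z, ∫⁻ w, f w ∂(K z.1).prod (L z.2) ∂π := by
  rw [shadow, lintegral_map hf measurable_snd, Measure.lintegral_compProd (by fun_prop)]
  simp_rw [shadowKernel_apply]

lemma lintegral_shadow_mul [SFinite π] [IsMarkovKernel K] [IsMarkovKernel L] {h : B' → ℝ≥0∞}
    {φ : A' → ℝ≥0∞} (hh : Measurable h) (hφ : Measurable φ) :
    ∫⁻ w, h w.2 * φ w.1 ∂shadow π K L =
      ∫⁻ z, (∫⁻ y, h y ∂L z.2) * (∫⁻ x, φ x ∂K z.1) ∂π := by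
  rw [lintegral_shadow (by fun_prop)]
  refine lintegral_congr fun z => ?_
  rw [mul_comm, ← lintegral_prod_mul hφ.aemeasurable hh.aemeasurable]
  simp_rw [mul_comm]

lemma lintegral_shadow_fst [IsProbabilityMeasure π] [IsMarkovKernel K] [IsMarkovKernel L]
    {φ : A' → ℝ≥0∞} (hφ : Measurable φ) :
    ∫⁻ w, φ w.1 ∂shadow π K L = ∫⁻ z, φ z.2 ∂(π.map Prod.fst ⊗ₘ K) := by
  have h := lintegral_shadow_mul (π := π) (K := K) (L := L) (h := fun _ => 1) measurable_const hφ
  simp only [one_mul, lintegral_const, measure_univ] at h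
  rw [h, Measure.lintegral_compProd (by fun_prop),
    lintegral_map hφ.lintegral_kernel measurable_fst]

lemma shadow_map_swap [SFinite π] [IsMarkovKernel K] [IsMarkovKernel L] :
    (shadow π K L).map Prod.swap = shadow (π.map Prod.swap) L K := by
  refine Measure.ext_of_lintegral _ fun f hf => ?_
  rw [lintegral_map hf measurable_swap, lintegral_shadow (by fun_prop), lintegral_shadow hf]
  have hm : Measurable fun z : B × A => ∫⁻ w, f w ∂(L z.1).prod (K z.2) := by
    simp_rw [← shadowKernel_apply]
    exact hf.lintegral_kernel
  rw [lintegral_map hm measurable_swap]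
  refine lintegral_congr fun z => ?_
  rw [Prod.fst_swap, Prod.snd_swap, ← Measure.prod_swap,
    lintegral_map (by fun_prop) measurable_swap]
  simp_rw [Prod.swap_swap]

lemma shadow_map_fst [IsProbabilityMeasure π] [IsMarkovKernel K] [IsMarkovKernel L] :
    (shadow π K L).map Prod.fst = (π.map Prod.fst ⊗ₘ K).map Prod.snd := by
  refine Measure.ext_of_lintegral _ fun f hf => ?_
  rw [lintegral_map hf measurable_fst, lintegral_map hf measurable_snd, lintegral_shadow_fst hf]

lemma map_snd_map_swap {ρ : Measure (A × B)} :
    (ρ.map Prod.swap).map Prod.snd = ρ.map Prod.fst := by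
  rw [Measure.map_map measurable_snd measurable_swap]
  rfl

lemma map_fst_map_swap {ρ : Measure (A × B)} :
    (ρ.map Prod.swap).map Prod.fst = ρ.map Prod.snd := by
  rw [Measure.map_map measurable_fst measurable_swap]
  rfl

lemma map_swap_map_swap {ρ : Measure (A × B)} : (ρ.map Prod.swap).map Prod.swap = ρ := by
  rw [Measure.map_map measurable_swap measurable_swap, Prod.swap_swap_eq, Measure.map_id]

lemma shadow_map_snd [IsProbabilityMeasure π] [IsMarkovKernel K] [IsMarkovKernel L] :
    (shadow π K L).map Prod.snd = (π.map Prod.snd ⊗ₘ L).map Prod.snd := by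
  have : IsProbabilityMeasure (π.map Prod.swap) :=
    Measure.isProbabilityMeasure_map measurable_swap.aemeasurable
  rw [← map_fst_map_swap, shadow_map_swap, shadow_map_fst, map_fst_map_swap]

end Shadow

section AdaptedShadow

variable {N : ℕ} {X X' Y Y' : Fin N → Type*} [∀ t, MeasurableSpace (X t)]
  [∀ t, MeasurableSpace (X' t)] [∀ t, MeasurableSpace (Y t)] [∀ t, MeasurableSpace (Y' t)]
  {π : Measure ((∀ t, X t) × (∀ t, Y t))} [IsProbabilityMeasure π]
  {K : Kernel (∀ t, X t) (∀ t, X' t)} [IsMarkovKernel K]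
  {L : Kernel (∀ t, Y t) (∀ t, Y' t)} [IsMarkovKernel L]

lemma causalDual_shadow (hπ : CausalDual π)
    (hK : CausalDual ((π.map Prod.fst ⊗ₘ K).map Prod.swap))
    (hL : CausalDual (π.map Prod.snd ⊗ₘ L)) : CausalDual (shadow π K L) := by
  have : IsProbabilityMeasure (π.map Prod.fst) :=
    Measure.isProbabilityMeasure_map measurable_fst.aemeasurable
  have : IsProbabilityMeasure (π.map Prod.snd) :=
    Measure.isProbabilityMeasure_map measurable_snd.aemeasurable
  intro t h hh
  obtain ⟨q, hq, hqφ⟩ := hL t h hh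
  obtain ⟨g, hg, hgφ⟩ := hπ t q hq
  obtain ⟨k, hk, hkφ⟩ := hK t g hg
  replace hh := hh.mono (pastσ_le t) le_rfl
  replace hq := hq.mono (pastσ_le t) le_rfl
  replace hg := hg.mono (pastσ_le t) le_rfl
  have hk' := hk.mono (pastσ_le t) le_rfl
  refine ⟨k, hk, fun φ hφ => ?_⟩
  have hLq : (fun y => ∫⁻ w, h w ∂L y) =ᵐ[π.map Prod.snd] q := by
    refine ae_eq_of_forall_setLIntegral_eq_of_sigmaFinite hh.lintegral_kernel hq fun s hs _ => ?_
    have hs1 : Measurable (s.indicator fun _ => (1 : ℝ≥0∞)) := measurable_const.indicator hs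
    have e := hqφ _ hs1
    rw [Measure.lintegral_compProd (by fun_prop), Measure.lintegral_compProd (by fun_prop)] at e
    rw [← lintegral_indicator hs, ← lintegral_indicator hs]
    refine Eq.trans (lintegral_congr fun y => ?_) (e.trans (lintegral_congr fun y => ?_))
    · by_cases hy : y ∈ s <;> simp [hy]
    · by_cases hy : y ∈ s <;> simp [hy]
  have hKφ : Measurable fun x => ∫⁻ w, φ w ∂K x := hφ.lintegral_kernel
  calc ∫⁻ w, h w.2 * φ w.1 ∂shadow π K L
      = ∫⁻ z, (∫⁻ y, h y ∂L z.2) * (∫⁻ x, φ x ∂K z.1) ∂π := lintegral_shadow_mul hh hφ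
    _ = ∫⁻ z, q z.2 * (∫⁻ x, φ x ∂K z.1) ∂π := by
        refine lintegral_congr_ae ?_
        filter_upwards [ae_of_ae_map measurable_snd.aemeasurable hLq] with z hz
        rw [hz]
    _ = ∫⁻ z, g z.1 * (∫⁻ x, φ x ∂K z.1) ∂π := hgφ _ hKφ
    _ = ∫⁻ x, g x * (∫⁻ w, φ w ∂K x) ∂(π.map Prod.fst) :=
        (lintegral_map (hg.mul hKφ) measurable_fst).symm
    _ = ∫⁻ z, g z.2 * φ z.1 ∂((π.map Prod.fst ⊗ₘ K).map Prod.swap) := by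
        rw [lintegral_map (by fun_prop) measurable_swap, Measure.lintegral_compProd (by fun_prop)]
        refine lintegral_congr fun x => ?_
        rw [← lintegral_const_mul _ hφ]
        rfl
    _ = ∫⁻ z, k z.1 * φ z.1 ∂((π.map Prod.fst ⊗ₘ K).map Prod.swap) := hkφ φ hφ
    _ = ∫⁻ w, k w.1 * φ w.1 ∂shadow π K L := by
        rw [lintegral_map (by fun_prop) measurable_swap]
        exact (lintegral_shadow_fst (hk'.mul hφ)).symm

lemma isCausal_shadow (hπ : IsCausal π) (hK : IsBicausal (π.map Prod.fst ⊗ₘ K))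
    (hL : IsBicausal (π.map Prod.snd ⊗ₘ L)) : IsCausal (shadow π K L) := by
  have : IsProbabilityMeasure (π.map Prod.fst) :=
    Measure.isProbabilityMeasure_map measurable_fst.aemeasurable
  have : IsProbabilityMeasure (π.map Prod.snd) :=
    Measure.isProbabilityMeasure_map measurable_snd.aemeasurable
  have : IsProbabilityMeasure ((π.map Prod.fst ⊗ₘ K).map Prod.swap) :=
    Measure.isProbabilityMeasure_map measurable_swap.aemeasurable
  exact isCausal_iff_causalDual.2 (causalDual_shadow (isCausal_iff_causalDual.1 hπ)
    (isCausal_iff_causalDual.1 hK.2) (isCausal_iff_causalDual.1 hL.1))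

lemma isAdapted_shadow {b : Flavor} (hπ : IsAdapted b π) (hK : IsBicausal (π.map Prod.fst ⊗ₘ K))
    (hL : IsBicausal (π.map Prod.snd ⊗ₘ L)) : IsAdapted b (shadow π K L) := by
  have hac : IsAnticausal π → IsAnticausal (shadow π K L) := by
    intro h
    have : IsProbabilityMeasure (π.map Prod.swap) :=
      Measure.isProbabilityMeasure_map measurable_swap.aemeasurable
    change IsCausal ((shadow π K L).map Prod.swap)
    rw [shadow_map_swap]
    exact isCausal_shadow h (by rwa [map_fst_map_swap]) (by rwa [map_snd_map_swap])
  cases b with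
  | plain => trivial
  | causal => exact isCausal_shadow hπ hK hL
  | anticausal => exact hac hπ
  | bicausal => exact ⟨isCausal_shadow hπ.1 hK hL, hac hπ.2⟩

/-- Gluing a coupling with bicausal couplings of its marginals preserves every flavor. -/
lemma shadow_mem_aCouplings {b : Flavor} {μ : Measure (∀ t, X t)} {ν : Measure (∀ t, Y t)}
    {μ' : Measure (∀ t, X' t)} {ν' : Measure (∀ t, Y' t)} (hπ : π ∈ aCouplings b μ ν)
    (hK : μ ⊗ₘ K ∈ aCouplings .bicausal μ μ') (hL : ν ⊗ₘ L ∈ aCouplings .bicausal ν ν') :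
    shadow π K L ∈ aCouplings b μ' ν' := by
  obtain ⟨⟨rfl, rfl⟩, hb⟩ := hπ
  exact ⟨⟨shadow_map_fst.trans hK.1.2, shadow_map_snd.trans hL.1.2⟩,
    isAdapted_shadow hb hK.2 hL.2⟩

lemma swap_mem_aCouplings_bicausal {μ : Measure (∀ t, X t)} {ν : Measure (∀ t, Y t)}
    {ρ : Measure ((∀ t, X t) × (∀ t, Y t))} (h : ρ ∈ aCouplings .bicausal μ ν) :
    ρ.map Prod.swap ∈ aCouplings .bicausal ν μ := by
  refine ⟨⟨map_fst_map_swap.trans h.1.2, map_snd_map_swap.trans h.1.1⟩, h.2.2, ?_⟩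
  change IsCausal ((ρ.map Prod.swap).map Prod.swap)
  rw [map_swap_map_swap]
  exact h.2.1

end AdaptedShadow

section Density

lemma KL_ne_top_of_le_smul {Ω : Type*} [MeasurableSpace Ω] {ρ P : Measure Ω} [IsFiniteMeasure ρ]
    [IsFiniteMeasure P] {C : ℝ≥0∞} (hC : C ≠ ∞) (h : ρ ≤ C • P) : KL ρ P ≠ ⊤ := by
  have hac : ρ ≪ P := (Measure.absolutelyContinuous_of_le h).trans
    Measure.smul_absolutelyContinuous
  have hle : ρ.rnDeriv P ≤ᵐ[P] fun _ => C := by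
    refine ae_le_of_forall_setLIntegral_le_of_sigmaFinite (Measure.measurable_rnDeriv _ _)
      fun s _ _ => ?_
    rw [setLIntegral_const]
    exact (Measure.setLIntegral_rnDeriv_le s).trans (h s)
  have hint : Integrable (llr ρ P) ρ := by
    rw [← integrable_rnDeriv_mul_log_iff hac]
    have hm : Measurable fun x => (ρ.rnDeriv P x).toReal :=
      (Measure.measurable_rnDeriv _ _).ennreal_toReal
    refine Integrable.of_bound (C := C.toReal ^ 2 + 1)
      (hm.mul (Real.measurable_log.comp hm)).aestronglyMeasurable ?_
    filter_upwards [hle] with x hx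
    have h1 : (ρ.rnDeriv P x).toReal ≤ C.toReal := ENNReal.toReal_mono hC hx
    have h0 : 0 ≤ (ρ.rnDeriv P x).toReal := ENNReal.toReal_nonneg
    generalize (ρ.rnDeriv P x).toReal = r at h0 h1 ⊢
    rcases h0.eq_or_lt with rfl | h0
    · simp only [zero_mul, norm_zero]
      positivity
    · have h2 := Real.log_le_self h0.le
      have h3 := mul_le_mul_of_nonneg_left (Real.one_sub_inv_le_log_of_pos h0) h0.le
      rw [mul_sub, mul_inv_cancel₀ h0.ne'] at h3
      rw [Real.norm_eq_abs, abs_le]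
      constructor <;> nlinarith
  rw [KL, if_pos ⟨hac, hint⟩]
  exact ENNReal.ofReal_ne_top

lemma ae_condKernel_le_smul {A B : Type*} [MeasurableSpace A] [MeasurableSingletonClass A]
    [MeasurableSpace B] [StandardBorelSpace B] [Nonempty B] {ρ : Measure (A × B)}
    [IsProbabilityMeasure ρ] (h : FinitelySupported ρ.fst) :
    ∃ C : ℝ≥0∞, C ≠ ∞ ∧ ∀ᵐ x ∂ρ.fst, ρ.condKernel x ≤ C • ρ.snd := by
  obtain ⟨s, hs⟩ := h
  refine ⟨∑ x ∈ s with ρ.fst {x} ≠ 0, (ρ.fst {x})⁻¹, ?_, ?_⟩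
  · refine ENNReal.sum_ne_top.2 fun x hx => ?_
    simpa using (Finset.mem_filter.1 hx).2
  · have h0 : ∀ᵐ x ∂ρ.fst, ∀ y ∈ s, ρ.fst {y} = 0 → x ≠ y := by
      refine (ae_ball_iff s.countable_toSet).2 fun y _ => ?_
      by_cases hy : ρ.fst {y} = 0
      · filter_upwards [measure_eq_zero_iff_ae_notMem.1 hy] with x hx _
        simpa using hx
      · exact ae_of_all _ fun x h => absurd h hy
    filter_upwards [h0, measure_eq_zero_iff_ae_notMem.1 hs] with x hx hxs
    have hxs' : x ∈ s := by simpa using hxs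
    have hx0 : ρ.fst {x} ≠ 0 := fun h => hx x hxs' h rfl
    refine Measure.le_iff.2 fun t ht => ?_
    rw [Measure.condKernel_apply_of_ne_zero hx0, Measure.smul_apply, smul_eq_mul]
    gcongr
    · exact Finset.single_le_sum (f := fun x => (ρ.fst {x})⁻¹) (fun _ _ => bot_le)
        (Finset.mem_filter.2 ⟨hxs', hx0⟩)
    · rw [Measure.snd_apply ht]
      exact measure_mono fun z hz => hz.2

lemma shadow_le_smul {A A' B B' : Type*} [MeasurableSpace A] [MeasurableSpace A']
    [MeasurableSpace B] [MeasurableSpace B'] {π : Measure (A × B)} [IsProbabilityMeasure π]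
    {K : Kernel A A'} {L : Kernel B B'} [IsMarkovKernel K] [IsMarkovKernel L]
    {μ' : Measure A'} {ν' : Measure B'} [SFinite μ'] [SFinite ν'] {C D : ℝ≥0∞}
    (hK : ∀ᵐ x ∂π.map Prod.fst, K x ≤ C • μ') (hL : ∀ᵐ y ∂π.map Prod.snd, L y ≤ D • ν') :
    shadow π K L ≤ (C * D) • μ'.prod ν' := by
  refine Measure.le_iff.2 fun s hs => ?_
  rw [← lintegral_indicator_one hs, lintegral_shadow (measurable_one.indicator hs)]
  calc ∫⁻ z, ∫⁻ w, s.indicator 1 w ∂(K z.1).prod (L z.2) ∂π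
      ≤ ∫⁻ _, ((C * D) • μ'.prod ν') s ∂π := by
        refine lintegral_mono_ae ?_
        filter_upwards [ae_of_ae_map measurable_fst.aemeasurable hK,
          ae_of_ae_map measurable_snd.aemeasurable hL] with z h1 h2
        rw [lintegral_indicator_one hs]
        refine (Measure.prod_mono h1 h2 s).trans_eq ?_
        rw [Measure.prod_smul_left, Measure.prod_smul_right, smul_smul]
    _ = ((C * D) • μ'.prod ν') s := by simp

end Density

section WeakApproximation

lemma lintegral_edist_le_lcost {A : Type*} [MeasurableSpace A] [PseudoEMetricSpace A]
    [OpensMeasurableSpace (A × A)] {p : ℝ} (hp : 1 ≤ p) (ρ : Measure (A × A))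
    [IsProbabilityMeasure ρ] : ∫⁻ z, edist z.1 z.2 ∂ρ ≤ lcost p ρ ^ (1 / p) := by
  have hm : AEStronglyMeasurable (fun z : A × A => edist z.1 z.2) ρ :=
    continuous_edist.aestronglyMeasurable
  simpa [eLpNorm', lcost] using eLpNorm'_le_eLpNorm'_of_exponent_le one_pos hp ρ hm

lemma lintegral_edist_map_swap {A : Type*} [MeasurableSpace A] [PseudoEMetricSpace A]
    (ρ : Measure (A × A)) :
    ∫⁻ z, edist z.1 z.2 ∂ρ.map Prod.swap = ∫⁻ z, edist z.1 z.2 ∂ρ := by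
  have := lintegral_map_equiv (μ := ρ) (fun z : A × A => edist z.1 z.2) MeasurableEquiv.prodComm
  refine this.trans (lintegral_congr fun z => ?_)
  exact edist_comm _ _

lemma edist_integral_shadow_le {A B : Type*} [MeasurableSpace A] [MeasurableSpace B]
    [PseudoEMetricSpace A] [PseudoEMetricSpace B] [BorelSpace A] [BorelSpace B]
    [SecondCountableTopology A] [SecondCountableTopology B]
    {π : Measure (A × B)} [IsProbabilityMeasure π] {K : Kernel A A} {L : Kernel B B}
    [IsMarkovKernel K] [IsMarkovKernel L] {f : A × B → ℝ} {C : ℝ} {l : ℝ≥0}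
    (hb : ∀ z, |f z| ≤ C) (hl : LipschitzWith l f) :
    edist (∫ z, f z ∂shadow π K L) (∫ z, f z ∂π) ≤
      l * (∫⁻ z, edist z.1 z.2 ∂(π.map Prod.fst ⊗ₘ K) +
        ∫⁻ z, edist z.1 z.2 ∂(π.map Prod.snd ⊗ₘ L)) := by
  let θ := π ⊗ₘ shadowKernel K L
  have hf : Measurable f := hl.continuous.measurable
  have h1 : ∫ z, f z ∂shadow π K L = ∫ w, f w.2 ∂θ :=
    integral_map measurable_snd.aemeasurable hf.aestronglyMeasurable
  have hθ : θ.map Prod.fst = π := Measure.fst_compProd _ _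
  have h2 : ∫ z, f z ∂π = ∫ w, f w.1 ∂θ := by
    conv_lhs => rw [← hθ]
    exact integral_map measurable_fst.aemeasurable hf.aestronglyMeasurable
  have i1 : Integrable (fun w => f w.2) θ :=
    Integrable.of_bound (hf.comp measurable_snd).aestronglyMeasurable C (ae_of_all _ fun _ => hb _)
  have i2 : Integrable (fun w => f w.1) θ :=
    Integrable.of_bound (hf.comp measurable_fst).aestronglyMeasurable C (ae_of_all _ fun _ => hb _)
  have e1 : ∫⁻ w, edist w.1.1 w.2.1 ∂θ = ∫⁻ z, edist z.1 z.2 ∂(π.map Prod.fst ⊗ₘ K) := by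
    have hm : Measurable fun x : A => ∫⁻ x', edist x x' ∂K x :=
      measurable_edist.lintegral_kernel_prod_right'
    rw [Measure.lintegral_compProd (by fun_prop), Measure.lintegral_compProd measurable_edist,
      lintegral_map hm measurable_fst]
    refine lintegral_congr fun z => ?_
    rw [shadowKernel_apply, lintegral_prod _ (by fun_prop)]
    simp
  have e2 : ∫⁻ w, edist w.1.2 w.2.2 ∂θ = ∫⁻ z, edist z.1 z.2 ∂(π.map Prod.snd ⊗ₘ L) := by
    have hm : Measurable fun x : B => ∫⁻ x', edist x x' ∂L x :=
      measurable_edist.lintegral_kernel_prod_right'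
    rw [Measure.lintegral_compProd (by fun_prop), Measure.lintegral_compProd measurable_edist,
      lintegral_map hm measurable_snd]
    refine lintegral_congr fun z => ?_
    rw [shadowKernel_apply, lintegral_prod _ (by fun_prop)]
    simp
  rw [h1, h2, edist_eq_enorm_sub, ← integral_sub i1 i2, ← e1, ← e2,
    ← lintegral_add_left (by fun_prop)]
  refine (enorm_integral_le_lintegral_enorm _).trans ?_
  rw [← lintegral_const_mul _ (by fun_prop)]
  refine lintegral_mono fun w => ?_
  rw [← edist_eq_enorm_sub, edist_comm]
  refine (hl w.1 w.2).trans ?_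
  gcongr
  rw [Prod.edist_eq]
  exact max_le le_self_add le_add_self

lemma isProbabilityMeasure_of_isCoupling {A B : Type*} [MeasurableSpace A] [MeasurableSpace B]
    {μ : Measure A} {ν : Measure B} [IsProbabilityMeasure μ] {π : Measure (A × B)}
    (h : IsCoupling μ ν π) : IsProbabilityMeasure π := by
  have : IsProbabilityMeasure (π.map Prod.fst) := by rwa [h.1]
  exact Measure.isProbabilityMeasure_of_map Prod.fst

lemma exists_lcost_lt {N : ℕ} {X : Fin N → Type*} [∀ t, MeasurableSpace (X t)]
    [∀ t, PseudoEMetricSpace (X t)] {p : ℝ} (hp : 1 ≤ p) {b : Flavor} {μ' μ : Measure (∀ t, X t)}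
    {η : ℝ≥0∞}
    (h : W p b μ' μ < η) : ∃ Γ ∈ aCouplings b μ' μ, lcost p Γ ^ (1 / p) < η := by
  have hp0 : 0 < 1 / p := by positivity
  by_contra! hcon
  refine h.not_ge ?_
  rw [W, ← ENNReal.rpow_inv_le_iff hp0]
  exact le_iInf fun Γ => (ENNReal.rpow_inv_le_iff hp0).2 (hcon Γ.1 Γ.2)

variable {N : ℕ} {X Y : Fin N → Type*}
    [∀ t, MeasurableSpace (X t)] [∀ t, MetricSpace (X t)]
    [∀ t, PolishSpace (X t)] [∀ t, BorelSpace (X t)]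
    [∀ t, MeasurableSpace (Y t)] [∀ t, MetricSpace (Y t)]
    [∀ t, PolishSpace (Y t)] [∀ t, BorelSpace (Y t)]

/-- A transport from `μ` to a finitely supported measure and back, through small bicausal
couplings. -/
lemma exists_kernels {p : ℝ} (hp : 1 ≤ p) {μ μ' : Measure (∀ t, X t)} [IsProbabilityMeasure μ]
    [IsProbabilityMeasure μ'] (hd : FinitelySupported μ') {η : ℝ≥0∞}
    (h : W p .bicausal μ' μ < η) :
    ∃ (K₁ K₂ : Kernel (∀ t, X t) (∀ t, X t)) (C : ℝ≥0∞), IsMarkovKernel K₁ ∧ IsMarkovKernel K₂ ∧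
      μ ⊗ₘ K₁ ∈ aCouplings .bicausal μ μ' ∧ μ' ⊗ₘ K₂ ∈ aCouplings .bicausal μ' μ ∧
      ∫⁻ z, edist z.1 z.2 ∂(μ ⊗ₘ K₁) < η ∧ ∫⁻ z, edist z.1 z.2 ∂(μ' ⊗ₘ K₂) < η ∧
      C ≠ ∞ ∧ ∀ᵐ x ∂μ', K₂ x ≤ C • μ := by
  obtain ⟨Γ, hΓ, hlt⟩ := exists_lcost_lt hp h
  have := isProbabilityMeasure_of_isCoupling hΓ.1
  have := isProbabilityMeasure_of_isCoupling (swap_mem_aCouplings_bicausal hΓ).1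
  have : Nonempty (∀ t, X t) := nonempty_of_isProbabilityMeasure μ
  have hΓ1 : Γ.fst = μ' := hΓ.1.1
  have hΓ2 : (Γ.map Prod.swap).fst = μ := (swap_mem_aCouplings_bicausal hΓ).1.1
  have e1 : μ ⊗ₘ (Γ.map Prod.swap).condKernel = Γ.map Prod.swap := by
    conv_lhs => rw [← hΓ2]
    exact Measure.disintegrate _ _
  have e2 : μ' ⊗ₘ Γ.condKernel = Γ := by
    conv_lhs => rw [← hΓ1]
    exact Measure.disintegrate _ _
  obtain ⟨C, hC, hCle⟩ := ae_condKernel_le_smul (ρ := Γ) (by rwa [hΓ1])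
  have hΓ3 : Γ.snd = μ := hΓ.1.2
  rw [hΓ1, hΓ3] at hCle
  have hlt' := (lintegral_edist_le_lcost hp Γ).trans_lt hlt
  refine ⟨(Γ.map Prod.swap).condKernel, Γ.condKernel, C, inferInstance, inferInstance, ?_, ?_, ?_,
    ?_, hC, hCle⟩
  · rw [e1]
    exact swap_mem_aCouplings_bicausal hΓ
  · rwa [e2]
  · rwa [e1, lintegral_edist_map_swap]
  · rwa [e2]

lemma exists_KL_ne_top_edist_le {p : ℝ} (hp : 1 ≤ p) {b : Flavor}
    {μ μ' : Measure (∀ t, X t)} {ν ν' : Measure (∀ t, Y t)} [IsProbabilityMeasure μ]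
    [IsProbabilityMeasure μ'] [IsProbabilityMeasure ν] [IsProbabilityMeasure ν']
    (hμ : FinitelySupported μ') (hν : FinitelySupported ν') {η : ℝ≥0∞}
    (hμη : W p .bicausal μ' μ < η) (hνη : W p .bicausal ν' ν < η)
    {π : Measure ((∀ t, X t) × (∀ t, Y t))} (hπ : π ∈ aCouplings b μ ν) :
    ∃ ρ ∈ aCouplings b μ ν, KL ρ (μ.prod ν) ≠ ⊤ ∧
      ∀ (f : (∀ t, X t) × (∀ t, Y t) → ℝ) (C : ℝ) (l : ℝ≥0), (∀ z, |f z| ≤ C) →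
        LipschitzWith l f → edist (∫ z, f z ∂ρ) (∫ z, f z ∂π) ≤ 4 * l * η := by
  obtain ⟨K₁, K₂, C, _, _, hK₁, hK₂, hK₁η, hK₂η, hC, hKC⟩ := exists_kernels hp hμ hμη
  obtain ⟨L₁, L₂, D, _, _, hL₁, hL₂, hL₁η, hL₂η, hD, hLD⟩ := exists_kernels hp hν hνη
  have := isProbabilityMeasure_of_isCoupling hπ.1
  have h1 := shadow_mem_aCouplings hπ hK₁ hL₁
  have h2 := shadow_mem_aCouplings h1 hK₂ hL₂
  refine ⟨_, h2, ?_, fun f M l hM hl => ?_⟩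
  · exact KL_ne_top_of_le_smul (ENNReal.mul_ne_top hC hD)
      (shadow_le_smul (by rwa [h1.1.1]) (by rwa [h1.1.2]))
  · have e1 := edist_integral_shadow_le (π := π) (K := K₁) (L := L₁) hM hl
    have e2 := edist_integral_shadow_le (π := shadow π K₁ L₁) (K := K₂) (L := L₂) hM hl
    rw [hπ.1.1, hπ.1.2] at e1
    rw [h1.1.1, h1.1.2] at e2
    calc _ ≤ l * (η + η) + l * (η + η) :=
          (edist_triangle _ _ _).trans (add_le_add (e2.trans (by gcongr)) (e1.trans (by gcongr)))
      _ = 4 * l * η := by ring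

/-- Adapted couplings with finite entropy are weakly dense in the adapted couplings. -/
lemma exists_seq_KL_ne_top_weakTendsto {p : ℝ} (hp : 1 ≤ p) {b : Flavor}
    {μ : Measure (∀ t, X t)} {ν : Measure (∀ t, Y t)} [IsProbabilityMeasure μ]
    [IsProbabilityMeasure ν] {μs : ℕ → Measure (∀ t, X t)} {νs : ℕ → Measure (∀ t, Y t)}
    (hμs : ∀ n, IsProbabilityMeasure (μs n)) (hνs : ∀ n, IsProbabilityMeasure (νs n))
    (hμsd : ∀ n, FinitelySupported (μs n)) (hνsd : ∀ n, FinitelySupported (νs n))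
    (hμconv : Tendsto (fun n => W p .bicausal (μs n) μ) atTop (𝓝 0))
    (hνconv : Tendsto (fun n => W p .bicausal (νs n) ν) atTop (𝓝 0))
    {π : Measure ((∀ t, X t) × (∀ t, Y t))} (hπ : π ∈ aCouplings b μ ν) :
    ∃ ρs : ℕ → Measure ((∀ t, X t) × (∀ t, Y t)), (∀ k, ρs k ∈ aCouplings b μ ν) ∧
      (∀ k, KL (ρs k) (μ.prod ν) ≠ ⊤) ∧ WeakTendsto ρs π := by
  have hex : ∀ k : ℕ, ∃ ρ ∈ aCouplings b μ ν, KL ρ (μ.prod ν) ≠ ⊤ ∧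
      ∀ (f : (∀ t, X t) × (∀ t, Y t) → ℝ) (C : ℝ) (l : ℝ≥0), (∀ z, |f z| ≤ C) →
        LipschitzWith l f → edist (∫ z, f z ∂ρ) (∫ z, f z ∂π) ≤ 4 * l * ((k : ℝ≥0∞) + 1)⁻¹ := by
    intro k
    have hk : (0 : ℝ≥0∞) < ((k : ℝ≥0∞) + 1)⁻¹ := by simp
    obtain ⟨n, hn⟩ := (hμconv.eventually_lt_const hk).exists
    obtain ⟨m, hm⟩ := (hνconv.eventually_lt_const hk).exists
    have := hμs n
    have := hνs m
    exact exists_KL_ne_top_edist_le hp (hμsd n) (hνsd m) hn hm hπ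
  choose ρs hρ hKL hlip using hex
  have hπp := isProbabilityMeasure_of_isCoupling hπ.1
  have hρp := fun k => isProbabilityMeasure_of_isCoupling (hρ k).1
  refine ⟨ρs, hρ, hKL, ?_⟩
  let Q : ProbabilityMeasure ((∀ t, X t) × (∀ t, Y t)) := ⟨π, hπp⟩
  let Qs : ℕ → ProbabilityMeasure ((∀ t, X t) × (∀ t, Y t)) := fun k => ⟨ρs k, hρp k⟩
  have hlim : Tendsto Qs atTop (𝓝 Q) := by
    refine tendsto_iff_forall_lipschitz_integral_tendsto.2 fun f ⟨C, hC⟩ ⟨l, hl⟩ => ?_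
    obtain ⟨z₀⟩ := nonempty_of_isProbabilityMeasure π
    have hb : ∀ z, |f z| ≤ C + |f z₀| := fun z => by
      have := hC z z₀
      rw [Real.dist_eq] at this
      calc |f z| = |f z - f z₀ + f z₀| := by ring_nf
        _ ≤ _ := (abs_add_le _ _).trans (by gcongr)
    rw [tendsto_iff_edist_tendsto_0]
    refine tendsto_of_tendsto_of_tendsto_of_le_of_le tendsto_const_nhds ?_ (fun _ => bot_le)
      (fun k => hlip k f _ l hb hl)
    have h0 : Tendsto (fun k : ℕ => ((k : ℝ≥0∞) + 1)⁻¹) atTop (𝓝 0) := by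
      have := (tendsto_add_atTop_iff_nat 1).2 ENNReal.tendsto_inv_nat_nhds_zero
      simpa using this
    simpa using ENNReal.Tendsto.const_mul h0
      (Or.inr (ENNReal.mul_ne_top (by simp) (ENNReal.coe_ne_top (r := l))))
  exact ProbabilityMeasure.tendsto_iff_forall_integral_tendsto.1 hlim

end WeakApproximation

section Moments

lemma FinitelySupported.memPp {A : Type*} [MeasurableSpace A] [MetricSpace A]
    {μ : Measure A} [IsProbabilityMeasure μ] {p : ℝ} (hp : 1 ≤ p) (h : FinitelySupported μ) :
    MemPp p μ := by
  obtain ⟨s, hs⟩ := h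
  intro x₀
  have hle : ∀ᵐ x ∂μ, edist x₀ x ^ p ≤ ∑ y ∈ s, edist x₀ y ^ p := by
    filter_upwards [measure_eq_zero_iff_ae_notMem.1 hs] with x hx
    have hxs : x ∈ s := by simpa using hx
    exact Finset.single_le_sum (f := fun y => edist x₀ y ^ p) (fun _ _ => bot_le) hxs
  refine ne_top_of_le_ne_top ?_ (lintegral_mono_ae hle)
  rw [lintegral_const, measure_univ, mul_one]
  exact ENNReal.sum_ne_top.2 fun y _ =>
    ENNReal.rpow_ne_top_of_nonneg (by linarith) (edist_ne_top _ _)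

lemma MemPp.of_lcost {A : Type*} [MeasurableSpace A] [MetricSpace A] [BorelSpace A]
    [SecondCountableTopology A] {μ' μ : Measure A} {Γ : Measure (A × A)} {p : ℝ} (hp : 1 ≤ p)
    (hΓ : IsCoupling μ' μ Γ) (h : MemPp p μ') (hlt : lcost p Γ ≠ ∞) : MemPp p μ := by
  intro x₀
  have hm : Measurable fun x : A => edist x₀ x ^ p := by fun_prop
  have h1 : ∫⁻ x, edist x₀ x ^ p ∂μ = ∫⁻ z, edist x₀ z.2 ^ p ∂Γ := by
    rw [← hΓ.2, lintegral_map hm measurable_snd]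
  have h2 : ∫⁻ x, edist x₀ x ^ p ∂μ' = ∫⁻ z, edist x₀ z.1 ^ p ∂Γ := by
    rw [← hΓ.1, lintegral_map hm measurable_fst]
  have h3 : ∫⁻ z, edist x₀ z.2 ^ p ∂Γ ≤
      ∫⁻ z, 2 ^ (p - 1) * (edist x₀ z.1 ^ p + edist z.1 z.2 ^ p) ∂Γ := by
    refine lintegral_mono fun z => ?_
    exact (ENNReal.rpow_le_rpow (edist_triangle _ z.1 _) (by linarith)).trans
      (ENNReal.rpow_add_le_mul_rpow_add_rpow _ _ hp)
  rw [h1]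
  refine ne_top_of_le_ne_top ?_ h3
  rw [lintegral_const_mul _ (by fun_prop), lintegral_add_left (by fun_prop), ← h2]
  exact ENNReal.mul_ne_top (ENNReal.rpow_ne_top_of_nonneg (by linarith) (by simp))
    (ENNReal.add_ne_top.2 ⟨h x₀, hlt⟩)

lemma memPp_of_tendsto_W {N : ℕ} {X : Fin N → Type*} [∀ t, MeasurableSpace (X t)]
    [∀ t, MetricSpace (X t)] [∀ t, PolishSpace (X t)] [∀ t, BorelSpace (X t)] {p : ℝ}
    (hp : 1 ≤ p) {b : Flavor} {μ : Measure (∀ t, X t)} {μs : ℕ → Measure (∀ t, X t)}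
    (hμs : ∀ n, IsProbabilityMeasure (μs n)) (hμsd : ∀ n, FinitelySupported (μs n))
    (hconv : Tendsto (fun n => W p b (μs n) μ) atTop (𝓝 0)) : MemPp p μ := by
  obtain ⟨n, hn⟩ := (hconv.eventually_lt_const one_pos).exists
  obtain ⟨Γ, hΓ, hlt⟩ := exists_lcost_lt hp hn
  have := hμs n
  refine MemPp.of_lcost hp hΓ.1 ((hμsd n).memPp hp) fun htop => ?_
  rw [htop, ENNReal.top_rpow_of_pos (by positivity)] at hlt
  exact not_top_lt hlt

lemma MemPp.integrable {A : Type*} [MeasurableSpace A] [MetricSpace A] [BorelSpace A]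
    [SecondCountableTopology A] {μ : Measure A} {p : ℝ} (h : MemPp p μ) (x₀ : A) :
    Integrable (fun x => (edist x₀ x).toReal ^ p) μ := by
  simp_rw [ENNReal.toReal_rpow]
  exact integrable_toReal_of_lintegral_ne_top (by fun_prop) (h x₀)

lemma GrowthLE.exists_integrable_bound {A B : Type*} [MeasurableSpace A] [MetricSpace A]
    [BorelSpace A] [SecondCountableTopology A] [MeasurableSpace B] [MetricSpace B] [BorelSpace B]
    [SecondCountableTopology B] {μ : Measure A} {ν : Measure B} [IsFiniteMeasure μ] {p : ℝ}
    {c : A × B → ℝ} (h : GrowthLE p c) (hμ : MemPp p μ) (hν : MemPp p ν) :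
    ∃ (u : A → ℝ) (v : B → ℝ), Integrable u μ ∧ Integrable v ν ∧
      ∀ z, |c z| ≤ u z.1 + v z.2 := by
  obtain ⟨x₀, y₀, M, hM⟩ := h
  refine ⟨fun x => M * (1 + (edist x₀ x).toReal ^ p), fun y => M * (edist y₀ y).toReal ^ p,
    ((integrable_const _).add (hμ.integrable x₀)).const_mul M, (hν.integrable y₀).const_mul M,
    fun z => (hM z).trans_eq (by ring)⟩

end Moments

section UniformIntegrability

variable {A B : Type*} [MeasurableSpace A] [MeasurableSpace B] {μ : Measure A} {ν : Measure B}
  {π : Measure (A × B)} {u : A → ℝ} {v : B → ℝ} {c : A × B → ℝ}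

lemma IsCoupling.integrable_fst (h : IsCoupling μ ν π) (hu : Integrable u μ) :
    Integrable (fun z => u z.1) π := by
  rw [← h.1] at hu
  exact hu.comp_measurable measurable_fst

lemma IsCoupling.integrable_snd (h : IsCoupling μ ν π) (hv : Integrable v ν) :
    Integrable (fun z => v z.2) π := by
  rw [← h.2] at hv
  exact hv.comp_measurable measurable_snd

lemma IsCoupling.integral_fst (h : IsCoupling μ ν π) (hu : Integrable u μ) :
    ∫ z, u z.1 ∂π = ∫ x, u x ∂μ := by
  have hu' := hu.aestronglyMeasurable
  rw [← h.1] at hu' ⊢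
  exact (integral_map measurable_fst.aemeasurable hu').symm

lemma IsCoupling.integral_snd (h : IsCoupling μ ν π) (hv : Integrable v ν) :
    ∫ z, v z.2 ∂π = ∫ x, v x ∂ν := by
  have hv' := hv.aestronglyMeasurable
  rw [← h.2] at hv' ⊢
  exact (integral_map measurable_snd.aemeasurable hv').symm

lemma IsCoupling.integrable (h : IsCoupling μ ν π) (hu : Integrable u μ) (hv : Integrable v ν)
    (hc : AEStronglyMeasurable c π) (hle : ∀ z, |c z| ≤ u z.1 + v z.2) : Integrable c π :=
  ((h.integrable_fst hu).add (h.integrable_snd hv)).mono' hc (ae_of_all _ hle)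

lemma IsCoupling.neg_le_integral (h : IsCoupling μ ν π) (hu : Integrable u μ)
    (hv : Integrable v ν) (hc : AEStronglyMeasurable c π) (hle : ∀ z, |c z| ≤ u z.1 + v z.2) :
    -(∫ x, u x ∂μ + ∫ y, v y ∂ν) ≤ ∫ z, c z ∂π := by
  rw [← h.integral_fst hu, ← h.integral_snd hv,
    ← integral_add (h.integrable_fst hu) (h.integrable_snd hv), ← integral_neg]
  exact integral_mono ((h.integrable_fst hu).add (h.integrable_snd hv)).neg
    (h.integrable hu hv hc hle) fun z => (abs_le.1 (hle z)).1

lemma tendsto_integral_max_sub (hu : Integrable u μ) :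
    Tendsto (fun R : ℕ => ∫ x, max (u x - R) 0 ∂μ) atTop (𝓝 0) := by
  have h := tendsto_integral_of_dominated_convergence (μ := μ)
    (F := fun (R : ℕ) x => max (u x - R) 0) (f := fun _ => 0) (fun x => |u x|)
    (fun R => by
      have := hu.aestronglyMeasurable
      fun_prop) hu.abs
    (fun R => ae_of_all _ fun x => by
      rw [Real.norm_eq_abs, abs_of_nonneg (le_max_right _ _)]
      exact max_le (by linarith [le_abs_self (u x), R.cast_nonneg (α := ℝ)]) (abs_nonneg _))
    (ae_of_all _ fun x => by
      refine tendsto_const_nhds.congr' ?_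
      filter_upwards [eventually_ge_atTop ⌈u x⌉₊] with R hR
      rw [max_eq_right]
      linarith [Nat.ceil_le.1 hR])
  simpa using h

/-- Weak convergence of couplings with fixed marginals extends to continuous integrands dominated
by a sum of functions integrable for the marginals. -/
lemma WeakTendsto.tendsto_integral_of_isCoupling [TopologicalSpace A] [TopologicalSpace B]
    [OpensMeasurableSpace (A × B)] [IsFiniteMeasure μ] [IsFiniteMeasure ν]
    {πs : ℕ → Measure (A × B)} [∀ k, IsFiniteMeasure (πs k)] [IsFiniteMeasure π]
    (hlim : WeakTendsto πs π) (hπs : ∀ k, IsCoupling μ ν (πs k)) (hπ : IsCoupling μ ν π)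
    (hu : Integrable u μ) (hv : Integrable v ν) (hc : Continuous c)
    (hle : ∀ z, |c z| ≤ u z.1 + v z.2) :
    Tendsto (fun k => ∫ z, c z ∂πs k) atTop (𝓝 (∫ z, c z ∂π)) := by
  let cut : ℕ → BoundedContinuousFunction (A × B) ℝ := fun R =>
    BoundedContinuousFunction.ofNormedAddCommGroup (fun z => max (-(2 * R : ℝ)) (min (2 * R) (c z)))
      (by fun_prop) (2 * R) fun z => by
        rw [Real.norm_eq_abs, abs_le]
        have : (0 : ℝ) ≤ 2 * R := by positivity
        exact ⟨le_max_left _ _, max_le (by linarith) (min_le_left _ _)⟩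
  have hcut : ∀ (R : ℕ) z, |c z - cut R z| ≤ max (u z.1 - R) 0 + max (v z.2 - R) 0 := by
    intro R z
    have h0 : (0 : ℝ) ≤ 2 * R := by positivity
    have h1 := hle z
    have h2 := le_max_left (u z.1 - R) 0
    have h3 := le_max_left (v z.2 - R) 0
    have h4 := le_max_right (u z.1 - R) 0
    have h5 := le_max_right (v z.2 - R) 0
    change |c z - max (-(2 * R : ℝ)) (min (2 * R) (c z))| ≤ _
    rw [abs_le] at h1 ⊢
    rcases le_total (2 * R : ℝ) (c z) with h | h
    · rw [min_eq_left h, max_eq_right (show -(2 * R : ℝ) ≤ 2 * R by linarith)]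
      constructor <;> linarith
    · rw [min_eq_right h]
      rcases le_total (-(2 * R) : ℝ) (c z) with h' | h'
      · rw [max_eq_right h']
        constructor <;> linarith
      · rw [max_eq_left h']
        constructor <;> linarith
  let r : ℕ → ℝ := fun R => ∫ x, max (u x - R) 0 ∂μ + ∫ y, max (v y - R) 0 ∂ν
  have hr : Tendsto r atTop (𝓝 0) := by
    simpa using (tendsto_integral_max_sub hu).add (tendsto_integral_max_sub hv)
  have hest : ∀ (R : ℕ) (ρ : Measure (A × B)), IsFiniteMeasure ρ → IsCoupling μ ν ρ →
      |∫ z, c z ∂ρ - ∫ z, cut R z ∂ρ| ≤ r R := by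
    intro R ρ _ hρ
    have hu' : Integrable (fun x => max (u x - R) 0) μ :=
      (hu.sub (integrable_const _)).pos_part
    have hv' : Integrable (fun x => max (v x - R) 0) ν :=
      (hv.sub (integrable_const _)).pos_part
    rw [← integral_sub (hρ.integrable hu hv hc.measurable.aestronglyMeasurable hle)
      ((cut R).integrable ρ)]
    refine abs_integral_le_integral_abs.trans ?_
    change _ ≤ ∫ x, max (u x - R) 0 ∂μ + ∫ y, max (v y - R) 0 ∂ν
    rw [← hρ.integral_fst hu', ← hρ.integral_snd hv',
      ← integral_add (hρ.integrable_fst hu') (hρ.integrable_snd hv')]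
    exact integral_mono_of_nonneg (ae_of_all _ fun _ => abs_nonneg _)
      ((hρ.integrable_fst hu').add (hρ.integrable_snd hv')) (ae_of_all _ (hcut R))
  rw [Metric.tendsto_atTop']
  intro ε hε
  obtain ⟨R, hR⟩ := (hr.eventually_lt_const (show 0 < ε / 3 by positivity)).exists
  obtain ⟨k₀, hk₀⟩ := Metric.tendsto_atTop'.1 (hlim (cut R)) (ε / 3) (by positivity)
  refine ⟨k₀, fun k hk => ?_⟩
  have e1 := hest R (πs k) inferInstance (hπs k)
  have e2 := hest R π inferInstance hπ
  have e3 := hk₀ k hk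
  rw [Real.dist_eq] at e3 ⊢
  rw [abs_le] at e1 e2
  rw [abs_lt] at e3 ⊢
  constructor <;> linarith

end UniformIntegrability

section Closedness

variable {A B : Type*} [MeasurableSpace A] [MeasurableSpace B] [TopologicalSpace A]
  [TopologicalSpace B] {μ : Measure A} {ν : Measure B}
  {π : Measure (A × B)} {πs : ℕ → Measure (A × B)}

lemma WeakTendsto.map {A' B' : Type*} [MeasurableSpace A'] [MeasurableSpace B']
    [TopologicalSpace A'] [TopologicalSpace B'] [OpensMeasurableSpace A'] [BorelSpace B']
    {ρs : ℕ → Measure A'} {ρ : Measure A'} (h : WeakTendsto ρs ρ) {f : A' → B'}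
    (hf : Continuous f) : WeakTendsto (fun k => (ρs k).map f) (ρ.map f) := by
  intro g
  have hi : ∀ ρ : Measure A', ∫ y, g y ∂ρ.map f = ∫ x, g.compContinuous ⟨f, hf⟩ x ∂ρ :=
    fun ρ => integral_map_of_stronglyMeasurable hf.measurable
      g.continuous.measurable.stronglyMeasurable
  simp_rw [hi]
  exact h _

lemma WeakTendsto.eq_of_forall_eq {B' : Type*} [MeasurableSpace B'] [TopologicalSpace B']
    [BorelSpace B'] [HasOuterApproxClosed B'] {ρs : ℕ → Measure B'} {ρ ρ' : Measure B'}
    [IsFiniteMeasure ρ] [IsFiniteMeasure ρ'] (h : WeakTendsto ρs ρ) (h' : WeakTendsto ρs ρ') :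
    ρ = ρ' :=
  ext_of_forall_integral_eq_of_IsFiniteMeasure fun f => tendsto_nhds_unique (h f) (h' f)

lemma WeakTendsto.isCoupling [BorelSpace A] [BorelSpace B] [OpensMeasurableSpace (A × B)]
    [HasOuterApproxClosed A] [HasOuterApproxClosed B] [IsFiniteMeasure μ] [IsFiniteMeasure ν]
    [IsFiniteMeasure π] (h : WeakTendsto πs π) (hπs : ∀ k, IsCoupling μ ν (πs k)) :
    IsCoupling μ ν π := by
  have h1 := h.map continuous_fst
  have h2 := h.map continuous_snd
  simp_rw [(hπs _).1] at h1
  simp_rw [(hπs _).2] at h2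
  exact ⟨h1.eq_of_forall_eq fun _ => tendsto_const_nhds,
    h2.eq_of_forall_eq fun _ => tendsto_const_nhds⟩

/-- Weak convergence of measures with a fixed first marginal `μ` extends to products of bounded
continuous functions of `y` and `μ`-integrable functions of `x`. -/
lemma WeakTendsto.tendsto_integral_mul [BorelSpace A] [BorelSpace B] [NormalSpace A]
    [OpensMeasurableSpace (A × B)] [μ.WeaklyRegular] [IsFiniteMeasure μ]
    [∀ k, IsFiniteMeasure (πs k)] [IsFiniteMeasure π] (hlim : WeakTendsto πs π)
    (hπs : ∀ k, IsCoupling μ ν (πs k)) (hπ : IsCoupling μ ν π)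
    (h : BoundedContinuousFunction B ℝ) {u : A → ℝ} (hu : Integrable u μ) :
    Tendsto (fun k => ∫ z, h z.2 * u z.1 ∂πs k) atTop (𝓝 (∫ z, h z.2 * u z.1 ∂π)) := by
  have hmul : ∀ (ρ : Measure (A × B)) (w : A → ℝ), IsCoupling μ ν ρ → Integrable w μ →
      Integrable (fun z => h z.2 * w z.1) ρ := fun ρ w hρ hw =>
    (hρ.integrable_fst hw).bdd_mul
      (h.continuous.measurable.comp measurable_snd).aestronglyMeasurable
      (ae_of_all _ fun z => h.norm_coe_le_norm z.2)
  rw [Metric.tendsto_atTop']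
  intro ε hε
  have hh : 0 < ‖h‖ + 1 := by positivity
  obtain ⟨g, hg, hgi⟩ := hu.exists_boundedContinuous_integral_sub_le
    (show 0 < ε / 4 / (‖h‖ + 1) by positivity)
  have hest : ∀ ρ : Measure (A × B), IsCoupling μ ν ρ →
      |∫ z, h z.2 * u z.1 ∂ρ - ∫ z, h z.2 * g z.1 ∂ρ| ≤ ε / 4 := by
    intro ρ hρ
    have hi : Integrable (fun x => ‖u x - g x‖) μ := (hu.sub hgi).norm
    rw [← integral_sub (hmul ρ u hρ hu) (hmul ρ g hρ hgi)]
    refine abs_integral_le_integral_abs.trans ?_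
    calc ∫ z, |h z.2 * u z.1 - h z.2 * g z.1| ∂ρ
        ≤ ∫ z, (‖h‖ + 1) * ‖u z.1 - g z.1‖ ∂ρ := by
          refine integral_mono_of_nonneg (ae_of_all _ fun _ => abs_nonneg _)
            ((hρ.integrable_fst hi).const_mul _) (ae_of_all _ fun z => ?_)
          dsimp only
          rw [← mul_sub, abs_mul, Real.norm_eq_abs]
          gcongr
          have := h.norm_coe_le_norm z.2
          rw [Real.norm_eq_abs] at this
          linarith
      _ = (‖h‖ + 1) * ∫ x, ‖u x - g x‖ ∂μ := by
          rw [integral_const_mul, hρ.integral_fst hi]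
      _ ≤ ε / 4 := by
          rw [le_div_iff₀ hh] at hg
          linarith
  obtain ⟨k₀, hk₀⟩ := Metric.tendsto_atTop'.1
    (hlim (h.compContinuous ⟨Prod.snd, continuous_snd⟩ *
      g.compContinuous ⟨Prod.fst, continuous_fst⟩)) (ε / 2) (by positivity)
  refine ⟨k₀, fun k hk => ?_⟩
  have e1 := hest (πs k) (hπs k)
  have e2 := hest π hπ
  have e3 := hk₀ k hk
  simp only [BoundedContinuousFunction.coe_mul, Pi.mul_apply,
    BoundedContinuousFunction.compContinuous_apply, ContinuousMap.coe_mk] at e3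
  rw [Real.dist_eq] at e3 ⊢
  rw [abs_le] at e1 e2
  rw [abs_lt] at e3 ⊢
  constructor <;> linarith

lemma WeakTendsto.withDensity_map [BorelSpace A] [BorelSpace B] [NormalSpace A]
    [OpensMeasurableSpace (A × B)] [μ.WeaklyRegular] [IsFiniteMeasure μ]
    [∀ k, IsFiniteMeasure (πs k)] [IsFiniteMeasure π] (hlim : WeakTendsto πs π)
    (hπs : ∀ k, IsCoupling μ ν (πs k)) (hπ : IsCoupling μ ν π)
    {B' : Type*} [MeasurableSpace B'] [TopologicalSpace B'] [BorelSpace B'] {q : B → B'}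
    (hq : Continuous q) {w : A → ℝ≥0∞} (hw : Measurable w) (hwi : ∫⁻ x, w x ∂μ ≠ ∞) :
    WeakTendsto (fun k => ((πs k).withDensity fun z => w z.1).map fun z => q z.2)
      ((π.withDensity fun z => w z.1).map fun z => q z.2) := by
  intro h
  have hi : ∀ ρ : Measure (A × B), IsCoupling μ ν ρ →
      ∫ y, h y ∂((ρ.withDensity fun z => w z.1).map fun z => q z.2) =
        ∫ z, h.compContinuous ⟨q, hq⟩ z.2 * (w z.1).toReal ∂ρ := by
    intro ρ hρ
    have hlt : ∀ᵐ z ∂ρ, w z.1 < ∞ := by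
      have := ae_lt_top hw hwi
      rw [← hρ.1] at this
      exact ae_of_ae_map measurable_fst.aemeasurable this
    have hqm : Measurable fun z : A × B => q z.2 := hq.measurable.comp measurable_snd
    rw [integral_map_of_stronglyMeasurable hqm
        h.continuous.measurable.stronglyMeasurable,
      integral_withDensity_eq_integral_toReal_smul (by fun_prop) hlt]
    refine integral_congr_ae (ae_of_all _ fun z => ?_)
    simp [mul_comm]
  rw [hi π hπ]
  simp_rw [hi _ (hπs _)]
  exact hlim.tendsto_integral_mul hπs hπ _ (integrable_toReal_of_lintegral_ne_top
    hw.aemeasurable hwi)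

end Closedness

section AdaptedClosedness

variable {N : ℕ} {X Y : Fin N → Type*} [∀ t, MeasurableSpace (X t)] [∀ t, MeasurableSpace (Y t)]

lemma pastσ_eq_comap (t : ℕ) :
    pastσ Y t = MeasurableSpace.comap
      (fun (y : ∀ s, Y s) (s : {s : Fin N // (s : ℕ) < t}) => y s) MeasurableSpace.pi := by
  rw [MeasurableSpace.pi, MeasurableSpace.comap_iSup, iSup_subtype]
  simp_rw [MeasurableSpace.comap_comp]
  rfl

/-- Causality as equality of weighted laws of the past of `y`. -/
lemma causalTest_iff_withDensity {μ : Measure (∀ t, X t)}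
    {π : Measure ((∀ t, X t) × (∀ t, Y t))} :
    CausalTest μ π ↔ ∀ (t : Fin N) (A D : Set (∀ t, X t)) (a : (∀ t, X t) → ℝ≥0∞),
      MeasurableSet[coordσ X t] A → MeasurableSet[pastσ X t] D → IsCondProb μ (pastσ X t) A a →
      ((π.withDensity fun z => (A ∩ D).indicator 1 z.1).map
          fun z (s : {s : Fin N // (s : ℕ) < t}) => z.2 s) =
        (π.withDensity fun z => D.indicator a z.1).map
          fun z (s : {s : Fin N // (s : ℕ) < t}) => z.2 s := by
  have hm : ∀ t : Fin N, Measurable fun (y : ∀ s, Y s) (s : {s : Fin N // (s : ℕ) < t}) => y s :=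
    fun t => by fun_prop
  have key : ∀ (t : Fin N) (A D : Set (∀ t, X t)) (a : (∀ t, X t) → ℝ≥0∞),
      MeasurableSet[coordσ X t] A → MeasurableSet[pastσ X t] D → IsCondProb μ (pastσ X t) A a →
      ∀ E : Set (∀ s : {s : Fin N // (s : ℕ) < t}, Y s), MeasurableSet E →
      ((π.withDensity fun z => (A ∩ D).indicator 1 z.1).map
          fun z (s : {s : Fin N // (s : ℕ) < t}) => z.2 s) E =
        π ((A ∩ D) ×ˢ ((fun (y : ∀ s, Y s) (s : {s : Fin N // (s : ℕ) < t}) => y s) ⁻¹' E)) ∧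
      ((π.withDensity fun z => D.indicator a z.1).map
          fun z (s : {s : Fin N // (s : ℕ) < t}) => z.2 s) E =
        ∫⁻ z in D ×ˢ ((fun (y : ∀ s, Y s) (s : {s : Fin N // (s : ℕ) < t}) => y s) ⁻¹' E),
          a z.1 ∂π := by
    intro t A D a hA hD ha E hE
    have hA' := coordσ_le t _ hA
    have hD' := pastσ_le t _ hD
    have hmE : MeasurableSet (Prod.snd ⁻¹' ((fun (y : ∀ s, Y s)
        (s : {s : Fin N // (s : ℕ) < t}) => y s) ⁻¹' E) : Set ((∀ t, X t) × (∀ t, Y t))) :=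
      measurable_snd (hm t hE)
    have hmt : Measurable fun (z : (∀ t, X t) × (∀ t, Y t))
        (s : {s : Fin N // (s : ℕ) < t}) => z.2 s := (hm t).comp measurable_snd
    have hrw : ∀ w : (∀ t, X t) → ℝ≥0∞, ((π.withDensity fun z => w z.1).map
        fun z (s : {s : Fin N // (s : ℕ) < t}) => z.2 s) E = ∫⁻ z in Prod.snd ⁻¹'
          ((fun (y : ∀ s, Y s) (s : {s : Fin N // (s : ℕ) < t}) => y s) ⁻¹' E), w z.1 ∂π :=
      fun w => by
        rw [Measure.map_apply hmt hE]
        exact withDensity_apply _ hmE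
    rw [hrw, hrw]
    constructor
    · have h1 := lintegral_indicator_one (μ := π.restrict (Prod.snd ⁻¹'
          ((fun (y : ∀ s, Y s) (s : {s : Fin N // (s : ℕ) < t}) => y s) ⁻¹' E)))
        (measurable_fst (hA'.inter hD'))
      rw [Measure.restrict_apply (measurable_fst (hA'.inter hD')), ← Set.prod_eq] at h1
      exact h1
    · have h1 := lintegral_indicator (μ := π.restrict (Prod.snd ⁻¹'
          ((fun (y : ∀ s, Y s) (s : {s : Fin N // (s : ℕ) < t}) => y s) ⁻¹' E)))
        (measurable_fst hD') (fun z => a z.1)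
      rw [Measure.restrict_restrict (measurable_fst hD'), ← Set.prod_eq] at h1
      exact h1
  constructor
  · intro h t A D a hA hD ha
    refine Measure.ext fun E hE => ?_
    obtain ⟨h1, h2⟩ := key t A D a hA hD ha E hE
    rw [h1, h2]
    exact h t A D _ a hA hD (by rw [pastσ_eq_comap]; exact ⟨E, hE, rfl⟩) ha
  · intro h t A D B a hA hD hB ha
    rw [pastσ_eq_comap] at hB
    obtain ⟨E, hE, rfl⟩ := hB
    obtain ⟨h1, h2⟩ := key t A D a hA hD ha E hE
    rw [← h1, ← h2, h t A D a hA hD ha]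

variable [∀ t, MetricSpace (X t)] [∀ t, PolishSpace (X t)] [∀ t, BorelSpace (X t)]
  [∀ t, MetricSpace (Y t)] [∀ t, PolishSpace (Y t)] [∀ t, BorelSpace (Y t)]
  {μ : Measure (∀ t, X t)} {ν : Measure (∀ t, Y t)} [IsProbabilityMeasure μ]
  [IsProbabilityMeasure ν] {π : Measure ((∀ t, X t) × (∀ t, Y t))} [IsProbabilityMeasure π]
  {πs : ℕ → Measure ((∀ t, X t) × (∀ t, Y t))}

lemma WeakTendsto.isCausal (hlim : WeakTendsto πs π) (hπs : ∀ k, IsCoupling μ ν (πs k))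
    (hc : ∀ k, IsCausal (πs k)) : IsCausal π := by
  have hπ := hlim.isCoupling hπs
  have := fun k => isProbabilityMeasure_of_isCoupling (hπs k)
  rw [isCausal_iff_causalTest, hπ.1, causalTest_iff_withDensity]
  intro t A D a hA hD ha
  have hA' := coordσ_le t _ hA
  have hD' := pastσ_le t _ hD
  have hq : Continuous fun (y : ∀ s, Y s) (s : {s : Fin N // (s : ℕ) < t}) => y s := by fun_prop
  have hw1 : Measurable ((A ∩ D).indicator (1 : (∀ t, X t) → ℝ≥0∞)) :=
    measurable_one.indicator (hA'.inter hD')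
  have hw2 : Measurable (D.indicator a) := (ha.measurable.mono (pastσ_le t) le_rfl).indicator hD'
  have hi1 : ∫⁻ x, (A ∩ D).indicator (1 : (∀ t, X t) → ℝ≥0∞) x ∂μ ≠ ∞ := by
    rw [lintegral_indicator_one (hA'.inter hD')]
    exact measure_ne_top _ _
  have hi2 : ∫⁻ x, D.indicator a x ∂μ ≠ ∞ :=
    ne_top_of_le_ne_top ha.lintegral_ne_top (lintegral_mono (indicator_le_self _ _))
  have hfin : ∀ w : (∀ t, X t) → ℝ≥0∞, Measurable w → ∫⁻ x, w x ∂μ ≠ ∞ →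
      IsFiniteMeasure (π.withDensity fun z => w z.1) := fun w hw hwi =>
    isFiniteMeasure_withDensity (by rwa [← hπ.1, lintegral_map hw measurable_fst] at hwi)
  have := hfin _ hw1 hi1
  have := hfin _ hw2 hi2
  have h1 := hlim.withDensity_map hπs hπ hq hw1 hi1
  have h2 := hlim.withDensity_map hπs hπ hq hw2 hi2
  refine h1.eq_of_forall_eq ?_
  convert h2 using 2 with k
  have hk := isCausal_iff_causalTest.1 (hc k)
  rw [(hπs k).1] at hk
  exact causalTest_iff_withDensity.1 hk t A D a hA hD ha

/-- The set of adapted couplings is closed under weak convergence. -/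
lemma WeakTendsto.mem_aCouplings {b : Flavor} (hlim : WeakTendsto πs π)
    (hπs : ∀ k, πs k ∈ aCouplings b μ ν) : π ∈ aCouplings b μ ν := by
  have hcpl := fun k => (hπs k).1
  have hac : (∀ k, IsAnticausal (πs k)) → IsAnticausal π := by
    intro h
    have : IsProbabilityMeasure (π.map Prod.swap) :=
      Measure.isProbabilityMeasure_map measurable_swap.aemeasurable
    exact (hlim.map continuous_swap).isCausal (μ := ν) (ν := μ) (fun k =>
      ⟨map_fst_map_swap.trans (hcpl k).2, map_snd_map_swap.trans (hcpl k).1⟩) h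
  refine ⟨hlim.isCoupling hcpl, ?_⟩
  cases b with
  | plain => trivial
  | causal => exact hlim.isCausal hcpl fun k => (hπs k).2
  | anticausal => exact hac fun k => (hπs k).2
  | bicausal => exact ⟨hlim.isCausal hcpl fun k => (hπs k).2.1, hac fun k => (hπs k).2.2⟩

end AdaptedClosedness

section Limit

variable {N : ℕ} {X Y : Fin N → Type*} [∀ t, MeasurableSpace (X t)] [∀ t, MeasurableSpace (Y t)]
  {μ : Measure (∀ t, X t)} {ν : Measure (∀ t, Y t)} {b : Flavor} {c : (∀ t, X t) × (∀ t, Y t) → ℝ}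

lemma integral_le_entObj {Ω : Type*} [MeasurableSpace Ω] (c : Ω → ℝ) {ε : ℝ} (hε : 0 ≤ ε)
    (P π : Measure Ω) : ((∫ z, c z ∂π : ℝ) : EReal) ≤ entObj c ε P π :=
  le_add_of_nonneg_right (mul_nonneg (by exact_mod_cast hε) (by positivity))

lemma V_le_integral (hb : BddBelow (range fun π : aCouplings b μ ν => ∫ z, c z ∂π.1))
    {π : Measure ((∀ t, X t) × (∀ t, Y t))} (hπ : π ∈ aCouplings b μ ν) :
    V b μ ν c ≤ ∫ z, c z ∂π :=
  ciInf_le hb ⟨π, hπ⟩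

lemma V_le_EE (hb : BddBelow (range fun π : aCouplings b μ ν => ∫ z, c z ∂π.1))
    {ε : ℝ} (hε : 0 ≤ ε) : ((V b μ ν c : ℝ) : EReal) ≤ EE b μ ν c ε :=
  le_iInf fun π => (EReal.coe_le_coe_iff.2 (V_le_integral hb π.2)).trans
    (integral_le_entObj c hε _ _)

variable [IsProbabilityMeasure μ] [IsProbabilityMeasure ν]

lemma isCausal_prod : IsCausal (μ.prod ν) := by
  refine isCausal_iff_causalDual.2 fun t h hh => ⟨fun _ => ∫⁻ y, h y ∂ν, measurable_const,
    fun φ hφ => ?_⟩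
  have hh' : Measurable h := hh.mono (pastσ_le t) le_rfl
  rw [lintegral_prod _ (by fun_prop), lintegral_prod _ (by fun_prop)]
  refine lintegral_congr fun x => ?_
  dsimp only
  rw [lintegral_mul_const _ hh', lintegral_const, measure_univ, mul_one]

lemma prod_mem_aCouplings : μ.prod ν ∈ aCouplings b μ ν := by
  have hc : IsCausal (μ.prod ν) := isCausal_prod
  have hac : IsAnticausal (μ.prod ν) := by
    have : IsCausal ((μ.prod ν).map Prod.swap) := by
      rw [Measure.prod_swap]
      exact isCausal_prod
    exact this
  refine ⟨⟨by simp, by simp⟩, ?_⟩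
  cases b with
  | plain => trivial
  | causal => exact hc
  | anticausal => exact hac
  | bicausal => exact ⟨hc, hac⟩

instance : Nonempty (aCouplings b μ ν) := ⟨⟨_, prod_mem_aCouplings⟩⟩

/-- If every coupling can be approximated in cost by couplings of finite relative entropy, then
the entropic transport values converge to the transport value. -/
lemma tendsto_EE (hb : BddBelow (range fun π : aCouplings b μ ν => ∫ z, c z ∂π.1))
    (hd : ∀ π ∈ aCouplings b μ ν, ∀ a, ∫ z, c z ∂π < a →
      ∃ ρ ∈ aCouplings b μ ν, KL ρ (μ.prod ν) ≠ ∞ ∧ ∫ z, c z ∂ρ < a) :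
    Tendsto (fun ε => EE b μ ν c ε) (𝓝[>] (0 : ℝ)) (𝓝 ((V b μ ν c : ℝ) : EReal)) := by
  refine tendsto_order.2 ⟨fun a ha => ?_, fun a ha => ?_⟩
  · filter_upwards [self_mem_nhdsWithin] with ε hε
    exact ha.trans_le (V_le_EE hb (le_of_lt hε))
  · obtain ⟨r, hVr, hra⟩ := EReal.lt_iff_exists_real_btwn.1 ha
    obtain ⟨π, hπ⟩ := exists_lt_of_ciInf_lt (EReal.coe_lt_coe_iff.1 hVr)
    obtain ⟨ρ, hρ, hKL, hlt⟩ := hd π.1 π.2 r hπ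
    have hlim : Tendsto (fun ε : ℝ => ∫ z, c z ∂ρ + ε * (KL ρ (μ.prod ν)).toReal) (𝓝[>] 0)
        (𝓝 (∫ z, c z ∂ρ)) := by
      have h0 : Continuous fun ε : ℝ => ∫ z, c z ∂ρ + ε * (KL ρ (μ.prod ν)).toReal := by
        fun_prop
      simpa using (h0.tendsto 0).mono_left nhdsWithin_le_nhds
    filter_upwards [hlim.eventually_lt_const hlt] with ε hε
    refine ((iInf_le _ (⟨ρ, hρ⟩ : aCouplings b μ ν)).trans_eq ?_).trans_lt
      ((EReal.coe_lt_coe_iff.2 hε).trans hra)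
    rw [entObj, EReal.coe_add, EReal.coe_mul, EReal.coe_ennreal_toReal hKL]

end Limit

/-- Vanishing entropic regularization: under discrete approximability of
the marginals in `W_{p,bc}`, `E_•^ε(μ, ν, c) → V_•(μ, ν, c)` as `ε ↘ 0`, and every weak
accumulation point of the `E_•^ε`-optimizers is an optimizer of `V_•(μ, ν, c)`. -/
theorem stmt_12 {N : ℕ} (X Y : Fin N → Type*)
    [∀ t, MeasurableSpace (X t)] [∀ t, MetricSpace (X t)]
    [∀ t, PolishSpace (X t)] [∀ t, BorelSpace (X t)]
    [∀ t, MeasurableSpace (Y t)] [∀ t, MetricSpace (Y t)]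
    [∀ t, PolishSpace (Y t)] [∀ t, BorelSpace (Y t)]
    (p : ℝ) (hp : 1 ≤ p)
    (c : (∀ t, X t) × (∀ t, Y t) → ℝ) (hc : Continuous c) (hcg : GrowthLE p c)
    (μ : Measure (∀ t, X t)) (ν : Measure (∀ t, Y t))
    [IsProbabilityMeasure μ] [IsProbabilityMeasure ν]
    (μs : ℕ → Measure (∀ t, X t)) (νs : ℕ → Measure (∀ t, Y t))
    (hμs : ∀ n, IsProbabilityMeasure (μs n)) (hνs : ∀ n, IsProbabilityMeasure (νs n))
    (hμsd : ∀ n, FinitelySupported (μs n)) (hνsd : ∀ n, FinitelySupported (νs n))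
    (hμconv : Tendsto (fun n => W p .bicausal (μs n) μ) atTop (𝓝 0))
    (hνconv : Tendsto (fun n => W p .bicausal (νs n) ν) atTop (𝓝 0))
    (b : Flavor) :
    Tendsto (fun ε => EE b μ ν c ε) (𝓝[>] (0 : ℝ)) (𝓝 ((V b μ ν c : ℝ) : EReal)) ∧
    ∀ εs : ℕ → ℝ, (∀ k, 0 < εs k) → Tendsto εs atTop (𝓝 0) →
    ∀ πs : ℕ → Measure ((∀ t, X t) × (∀ t, Y t)),
      (∀ k, πs k ∈ aCouplings b μ ν) →
      (∀ k, entObj c (εs k) (μ.prod ν) (πs k) = EE b μ ν c (εs k)) →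
    ∀ π : Measure ((∀ t, X t) × (∀ t, Y t)), IsProbabilityMeasure π →
      WeakTendsto πs π →
      π ∈ aCouplings b μ ν ∧ ∫ z, c z ∂π = V b μ ν c := by
  have hμp := memPp_of_tendsto_W hp hμs hμsd hμconv
  have hνp := memPp_of_tendsto_W hp hνs hνsd hνconv
  obtain ⟨u, v, hu, hv, hle⟩ := hcg.exists_integrable_bound hμp hνp
  have hb : BddBelow (range fun π : aCouplings b μ ν => ∫ z, c z ∂π.1) :=
    ⟨_, forall_mem_range.2 fun π =>
      π.2.1.neg_le_integral hu hv hc.measurable.aestronglyMeasurable hle⟩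
  have hEE : Tendsto (fun ε => EE b μ ν c ε) (𝓝[>] (0 : ℝ)) (𝓝 ((V b μ ν c : ℝ) : EReal)) := by
    refine tendsto_EE hb fun π hπ a ha => ?_
    obtain ⟨ρs, hρs, hKL, hlim⟩ :=
      exists_seq_KL_ne_top_weakTendsto hp hμs hνs hμsd hνsd hμconv hνconv hπ
    have := fun k => isProbabilityMeasure_of_isCoupling (hρs k).1
    have := isProbabilityMeasure_of_isCoupling hπ.1
    obtain ⟨k, hk⟩ := ((hlim.tendsto_integral_of_isCoupling (fun k => (hρs k).1) hπ.1 hu hv hc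
      hle).eventually_lt_const ha).exists
    exact ⟨ρs k, hρs k, hKL k, hk⟩
  refine ⟨hEE, fun εs hεs hε πs hπs hopt π _ hlim => ?_⟩
  have hπ : π ∈ aCouplings b μ ν := hlim.mem_aCouplings hπs
  refine ⟨hπ, ?_⟩
  have := fun k => isProbabilityMeasure_of_isCoupling (hπs k).1
  have h1 := hlim.tendsto_integral_of_isCoupling (fun k => (hπs k).1) hπ.1 hu hv hc hle
  have h2 : Tendsto (fun k => EE b μ ν c (εs k)) atTop (𝓝 ((V b μ ν c : ℝ) : EReal)) :=
    hEE.comp (tendsto_nhdsWithin_iff.2 ⟨hε, Eventually.of_forall hεs⟩)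
  have h3 : Tendsto (fun k => ((∫ z, c z ∂πs k : ℝ) : EReal)) atTop
      (𝓝 ((V b μ ν c : ℝ) : EReal)) :=
    tendsto_of_tendsto_of_tendsto_of_le_of_le tendsto_const_nhds h2
      (fun k => EReal.coe_le_coe_iff.2 (V_le_integral hb (hπs k)))
      (fun k => (integral_le_entObj c (hεs k).le _ _).trans_eq (hopt k))
  exact tendsto_nhds_unique h1 (EReal.tendsto_coe.1 h3)

end AOT
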